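/- arXiv:2510.27581 — 2 statements merged into one kernel-verified Lean document; each statement's English description precedes it below -/
import Mathlib

section
/- For every ε > 0 there exists N₀ = N₀(q, ε) such that for every integer N ≥ N₀ there is a set A ⊆ {f ∈ 𝔽_q[t] : deg f ≤ N} with |A| ≥ exp((log 2 − ε) · (N · log q)/(q · log N)) such that no difference a − b with a, b ∈ A is of the form P − 1 with P ∈ 𝔽_q[t] irreducible. -/
open Polynomial

/-- The minimal polynomials of the elements of the degree `d` extension of `Fq` provide at least
`q ^ d / d` monic irreducible polynomials of degree at most `d`. -/
lemma exists_finset_monic_irreducible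
    (p : ℕ) [Fact p.Prime] (Fq : Type) [Field Fq] [Fintype Fq] [Algebra (ZMod p) Fq]
    (d : ℕ) (hd : d ≠ 0) :
    ∃ T : Finset Fq[X], (∀ P ∈ T, P.Monic ∧ Irreducible P ∧ P.natDegree ≤ d) ∧
      Fintype.card Fq ^ d ≤ d * T.card := by
  classical
  have : NeZero d := ⟨hd⟩
  have : CharP Fq p := charP_of_injective_algebraMap (algebraMap (ZMod p) Fq).injective p
  let K := FiniteField.Extension Fq p d
  have : Fintype K := Fintype.ofFinite K
  have hint (x : K) : IsIntegral Fq x := Algebra.IsIntegral.isIntegral x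
  have hdeg (x : K) : (minpoly Fq x).natDegree ≤ d :=
    (minpoly.natDegree_le x).trans_eq (FiniteField.finrank_extension Fq p d)
  refine ⟨Finset.univ.image (minpoly Fq : K → Fq[X]), ?_, ?_⟩
  · intro P hP
    obtain ⟨x, -, rfl⟩ := Finset.mem_image.mp hP
    exact ⟨minpoly.monic (hint x), minpoly.irreducible (hint x), hdeg x⟩
  · have hcard : Fintype.card Fq ^ d = (Finset.univ : Finset K).card := by
      rw [Finset.card_univ, Fintype.card_eq_nat_card, Fintype.card_eq_nat_card]
      exact (FiniteField.natCard_extension Fq p d).symm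
    rw [hcard]
    refine Finset.card_le_mul_card_image _ _ fun P hP => ?_
    obtain ⟨x, -, rfl⟩ := Finset.mem_image.mp hP
    refine le_trans (Finset.card_le_card (t := ((minpoly Fq x).aroots K).toFinset) ?_) ?_
    · intro y hy
      rw [Multiset.mem_toFinset, mem_aroots]
      refine ⟨minpoly.ne_zero (hint x), ?_⟩
      rw [← (Finset.mem_filter.mp hy).2]
      exact minpoly.aeval Fq y
    · calc _ ≤ _ := Multiset.toFinset_card_le _
        _ ≤ _ := card_roots' _
        _ ≤ d := by rw [natDegree_map]; exact hdeg x

/-- The Chinese remainder theorem for finitely many monic irreducible polynomials, with residues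
`0` and `1` prescribed by a set and a bound on the degree of the solution. -/
lemma exists_degree_lt_forall_dvd_sub_indicator {F : Type*} [Field F] (T : Finset F[X])
    (hT : ∀ P ∈ T, P.Monic ∧ Irreducible P) (S : Finset F[X]) :
    ∃ a : F[X], a.degree < (∏ P ∈ T, P).degree ∧
      (∀ P ∈ T, P ∈ S → P ∣ a - 1) ∧ ∀ P ∈ T, P ∉ S → P ∣ a := by
  classical
  have hco : Pairwise (Function.onFun IsCoprime fun P : T => Ideal.span {(P : F[X])}) := by
    intro P Q hPQ
    rw [Function.onFun, Ideal.isCoprime_span_singleton_iff]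
    refine ((hT P P.2).2.coprime_iff_not_dvd).2 fun h => hPQ (Subtype.ext ?_)
    exact eq_of_monic_of_associated (hT P P.2).1 (hT Q Q.2).1
      ((hT P P.2).2.associated_of_dvd (hT Q Q.2).2 h)
  obtain ⟨r, hr⟩ := Ideal.exists_forall_sub_mem_ideal hco
    fun P : T => if (P : F[X]) ∈ S then 1 else 0
  simp only [Ideal.mem_span_singleton] at hr
  have hdvd (P) (hP : P ∈ T) : P ∣ ∏ P ∈ T, P := Finset.dvd_prod_of_mem _ hP
  have hM : (∏ P ∈ T, P).Monic := monic_prod_of_monic _ _ fun P hP => (hT P hP).1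
  generalize ∏ P ∈ T, P = M at hdvd hM ⊢
  have hmod (P) (hP : P ∈ T) : P ∣ r %ₘ M - if P ∈ S then 1 else 0 := by
    have h := dvd_add ((hdvd P hP).trans (dvd_modByMonic_sub r M)) (hr ⟨P, hP⟩)
    rwa [sub_add_sub_cancel] at h
  refine ⟨r %ₘ M, degree_modByMonic_lt _ hM, fun P hP hPS => ?_, fun P hP hPS => ?_⟩
  · have h := hmod P hP
    rwa [if_pos hPS] at h
  · have h := hmod P hP
    rwa [if_neg hPS, sub_zero] at h

/-- A finite set of polynomials has a subset, smaller by a factor of at most `q ^ m`, in which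
no two distinct elements differ by a polynomial of degree less than `m`. -/
lemma exists_subset_separated {F : Type*} [Field F] [Fintype F] (B : Finset F[X]) (m : ℕ) :
    ∃ A ⊆ B, (∀ a ∈ A, ∀ b ∈ A, (a - b).degree < m → a = b) ∧
      B.card ≤ A.card * Fintype.card F ^ m := by
  classical
  let f : F[X] → ℕ → F := fun a i => a.coeff (m + i)
  let g : F[X] → Fin m → F := fun a i => a.coeff i
  obtain ⟨A, hAB, hinj, himg⟩ :=
    Finset.exists_subset_injOn_image_eq_of_surjOn (f := f) (B : Set F[X]) (B.image f)
      (by simpa using Set.surjOn_image f (B : Set F[X]))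
  refine ⟨A, by exact_mod_cast hAB, fun a ha b hb hab => hinj ha hb ?_, ?_⟩
  · funext i
    have := coeff_eq_zero_of_degree_lt (hab.trans_le (b := ((m : ℕ) : WithBot ℕ))
      (c := ((m + i : ℕ) : WithBot ℕ)) (by exact_mod_cast Nat.le_add_right m i))
    exact sub_eq_zero.mp (by simpa using this)
  · have hA : A.card = (B.image f).card := by
      rw [← himg, Finset.card_image_of_injOn hinj]
    have hg : Fintype.card F ^ m = (Finset.univ : Finset (Fin m → F)).card := by simp
    rw [hA, hg, ← Finset.card_product]
    refine Finset.card_le_card_of_injOn (fun a => (f a, g a)) ?_ ?_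
    · intro a ha
      simpa using ⟨a, ha, rfl⟩
    · intro a _ b _ hab
      obtain ⟨h1, h2⟩ := Prod.mk.inj hab
      ext i
      rcases lt_or_ge i m with hi | hi
      · exact congrFun h2 ⟨i, hi⟩
      · obtain ⟨j, rfl⟩ := Nat.exists_eq_add_of_le hi
        exact congrFun h1 j

/-- Lifting the middle layer of the cube `{0, 1} ^ (2 * n)` along the Chinese remainder theorem
yields a large set with no difference of the form `P - 1`. -/
lemma exists_finset_sub_ne_irreducible_sub_one
    (p : ℕ) [Fact p.Prime] (Fq : Type) [Field Fq] [Fintype Fq] [Algebra (ZMod p) Fq]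
    (d n N : ℕ) (hd : d ≠ 0) (hq : 2 * n * d ≤ Fintype.card Fq ^ d) (hN : 2 * n * d ≤ N) :
    ∃ A : Finset Fq[X], (∀ f ∈ A, f.degree ≤ N) ∧
      (∀ a ∈ A, ∀ b ∈ A, ∀ P : Fq[X], Irreducible P → a - b ≠ P - 1) ∧
      n.centralBinom ≤ A.card * Fintype.card Fq ^ (d + 1) := by
  classical
  obtain ⟨T₀, hT₀, hcard₀⟩ := exists_finset_monic_irreducible p Fq d hd
  obtain ⟨T, hTT₀, hTcard⟩ := Finset.exists_subset_card_eq (s := T₀) (n := 2 * n) <|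
    Nat.le_of_mul_le_mul_left ((mul_comm d _).trans_le (hq.trans hcard₀)) (Nat.pos_of_ne_zero hd)
  have hT (P) (hP : P ∈ T) := hT₀ P (hTT₀ hP)
  choose c hcdeg hc1 hc0 using
    exists_degree_lt_forall_dvd_sub_indicator T fun P hP => ⟨(hT P hP).1, (hT P hP).2.1⟩
  have hsep (S) (hS : S ∈ T.powersetCard n) (S') (hS' : S' ∈ T.powersetCard n) (hne : S ≠ S') :
      ∃ P ∈ T, P ∣ c S ∧ P ∣ c S' - 1 := by
    rw [Finset.mem_powersetCard] at hS hS'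
    have : ¬ S' ⊆ S := fun h => hne (Finset.eq_of_subset_of_card_le h (by omega)).symm
    obtain ⟨P, hP', hP⟩ := Finset.not_subset.mp this
    exact ⟨P, hS'.1 hP', hc0 S P (hS'.1 hP') hP, hc1 S' P (hS'.1 hP') hP'⟩
  have hinj : Set.InjOn c (T.powersetCard n) := by
    intro S hS S' hS' h
    by_contra hne
    obtain ⟨P, hP, h0, h1⟩ := hsep S hS S' hS' hne
    rw [← h] at h1
    exact (hT P hP).2.1.not_isUnit (isUnit_of_dvd_one (by simpa using dvd_sub h0 h1))
  obtain ⟨A, hA, hAsep, hAcard⟩ := exists_subset_separated ((T.powersetCard n).image c) (d + 1)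
  refine ⟨A, fun f hf => ?_, fun a ha b hb P hP hab => ?_, ?_⟩
  · obtain ⟨S, -, rfl⟩ := Finset.mem_image.mp (hA hf)
    refine (hcdeg S).le.trans (degree_le_of_natDegree_le ?_)
    calc _ ≤ ∑ P ∈ T, P.natDegree := natDegree_prod_le _ _
      _ ≤ T.card * d := Finset.sum_le_card_nsmul _ _ _ fun P hP => (hT P hP).2.2
      _ ≤ N := by rwa [hTcard]
  · have hne : a ≠ b := by
      rintro rfl
      rw [sub_self] at hab
      exact hP.not_isUnit (by rw [sub_eq_zero.mp hab.symm]; exact isUnit_one)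
    refine hne (hAsep a ha b hb ?_)
    obtain ⟨S, hS, rfl⟩ := Finset.mem_image.mp (hA ha)
    obtain ⟨S', hS', rfl⟩ := Finset.mem_image.mp (hA hb)
    obtain ⟨Q, hQ, h0, h1⟩ := hsep S hS S' hS' fun h => hne (congrArg c h)
    have hQP : Q ∣ P := by
      have h := dvd_sub h0 h1
      rwa [show c S - (c S' - 1) = P by linear_combination hab] at h
    have hdeg : P.degree < (d + 1 : ℕ) := by
      rw [← degree_eq_degree_of_associated ((hT Q hQ).2.1.associated_of_dvd hP hQP)]
      exact (degree_le_of_natDegree_le (hT Q hQ).2.2).trans_lt (by exact_mod_cast d.lt_succ_self)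
    rw [hab]
    refine (degree_sub_le _ _).trans_lt (max_lt hdeg ?_)
    rw [degree_one]
    exact_mod_cast d.succ_pos
  · rwa [Finset.card_image_of_injOn hinj, Finset.card_powersetCard, hTcard,
      ← Nat.centralBinom_eq_two_mul_choose] at hAcard

open Filter in
/-- The middle binomial coefficient with `2 * n ≈ N / logb q N` dominates the required bound. -/
lemma eventually_exp_mul_pow_le_centralBinom (q : ℕ) (hq : 2 ≤ q) :
    ∀ᶠ N : ℕ in atTop,
      Real.exp (Real.log 2 * (N * Real.log q) / (q * Real.log N)) * (q : ℝ) ^ (Nat.clog q N + 1) ≤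
        ((N / (2 * Nat.clog q N)).centralBinom : ℝ) := by
  have hcast := tendsto_natCast_atTop_atTop (R := ℝ)
  have hsmall : ∀ᶠ N : ℕ in atTop, 64 * Real.log N ^ 2 ≤ N := by
    have h := hcast.eventually
      ((Real.isLittleO_pow_log_id_atTop (n := 2)).bound (show (0 : ℝ) < 1 / 64 by norm_num))
    filter_upwards [h] with N hN
    rw [Real.norm_of_nonneg (by positivity), id, Real.norm_of_nonneg (by positivity)] at hN
    linarith
  filter_upwards [hsmall, (Real.tendsto_log_atTop.comp hcast).eventually_ge_atTop (3 * Real.log q),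
    eventually_ge_atTop 2] with N hsq hlog hN2
  simp only [Function.comp_apply] at hlog
  set d := Nat.clog q N
  set n := N / (2 * d)
  set c := Real.log q
  set l := Real.log N
  have hqR : (2 : ℝ) ≤ q := by exact_mod_cast hq
  have hlog2 : (0.69 : ℝ) < Real.log 2 := by linarith [Real.log_two_gt_d9]
  have hc : Real.log 2 ≤ c := Real.log_le_log (by norm_num) hqR
  have hl : 0 < l := by linarith
  have hd : 0 < d := Nat.clog_pos hq hN2
  have hdR : (0 : ℝ) < d := by exact_mod_cast hd
  have hNR : (0 : ℝ) < N := by exact_mod_cast (by omega : 0 < N)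
  have hdc : d * c ≤ l + c := by
    have h : ((q : ℝ) ^ (d - 1)) ≤ N := by
      exact_mod_cast (Nat.pow_pred_clog_lt_self hq hN2).le
    have h := Real.log_le_log (by positivity) h
    rw [Real.log_pow, Nat.cast_sub hd] at h
    push_cast at h
    linarith
  have hn : (N : ℝ) < 2 * d * (n + 1) := by
    exact_mod_cast Nat.lt_mul_div_succ N (by omega : 0 < 2 * d)
  have hx : N * c / l * (3 / 4) ≤ 2 * n + 2 := by
    rw [div_mul_eq_mul_div, div_le_iff₀ hl]
    have h1 : d * c ≤ 4 / 3 * l := by linarith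
    have h2 : N * c ≤ 2 * (n + 1) * (d * c) := by nlinarith
    have h3 : 2 * ((n : ℝ) + 1) * (d * c) ≤ 2 * (n + 1) * (4 / 3 * l) := by gcongr
    linarith
  have hbig : 64 * (l * c) ≤ N * c / l := by
    rw [le_div_iff₀ hl]
    nlinarith
  have hn4 : 4 ≤ n := by
    have h : 2 * 0.69 ≤ l * c := by nlinarith
    have : (3 : ℝ) < n := by linarith
    exact_mod_cast this
  have hnR : (0 : ℝ) < n := by exact_mod_cast (by omega : 0 < n)
  have hlogn : Real.log n ≤ l :=
    Real.log_le_log hnR (by exact_mod_cast Nat.div_le_self N (2 * d))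
  have hbinom : n * (2 * Real.log 2) ≤ l + Real.log n.centralBinom := by
    have h : ((4 : ℝ) ^ n) ≤ n * n.centralBinom := by
      exact_mod_cast (Nat.four_pow_lt_mul_centralBinom n hn4).le
    have h := Real.log_le_log (by positivity) h
    rw [Real.log_mul hnR.ne' (by exact_mod_cast n.centralBinom_ne_zero), Real.log_pow,
      show (4 : ℝ) = 2 ^ 2 by norm_num, Real.log_pow] at h
    push_cast at h
    linarith
  have hmain : Real.log 2 * (N * c) / (q * l) ≤ Real.log 2 * (N * c / l / 2) := by
    have hcpos : 0 < c := by linarith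
    rw [div_div, mul_div_assoc, mul_comm l 2]
    gcongr
  have hcb : (0 : ℝ) < n.centralBinom := by exact_mod_cast n.centralBinom_pos
  have hpow : (q : ℝ) ^ (d + 1) = Real.exp ((d + 1) * c) := by
    rw [← Real.exp_log (show (0 : ℝ) < (q : ℝ) ^ (d + 1) by positivity), Real.log_pow]
    push_cast
    rfl
  rw [hpow, ← Real.exp_add, ← Real.le_log_iff_exp_le hcb]
  have h1 : Real.log 2 * (N * c / l * (3 / 4)) ≤ Real.log 2 * (2 * n + 2) := by gcongr
  have h2 : 4 * l ≤ Real.log 2 * (N * c / l) / 4 := by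
    have : 0.69 * (64 * (l * 0.69)) ≤ Real.log 2 * (N * c / l) := by
      gcongr
      exact le_trans (by gcongr; linarith) hbig
    linarith
  linarith

/-- Ruzsa-type lower bound: for `N` large there is `A ⊆ {f : deg f ≤ N}` of size at least
`exp((log 2 − ε)·(N log q)/(q log N))` with no two elements differing by `P − 1`,
`P` irreducible. -/
theorem sarkozy_shifted_irreducibles_lower_bound
    (p : ℕ) [Fact p.Prime] (Fq : Type) [Field Fq] [Fintype Fq] [Algebra (ZMod p) Fq]
    (ε : ℝ) (hε : 0 < ε) :
    ∃ N₀ : ℕ, ∀ N : ℕ, N₀ ≤ N →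
      ∃ A : Finset (Polynomial Fq),
        (∀ f ∈ A, f.degree ≤ (N : ℕ)) ∧
        (∀ a ∈ A, ∀ b ∈ A, ∀ P : Polynomial Fq, Irreducible P → a - b ≠ P - 1) ∧
        Real.exp ((Real.log 2 - ε) * ((N : ℝ) * Real.log (Fintype.card Fq)) /
          ((Fintype.card Fq : ℝ) * Real.log (N : ℝ))) ≤ (A.card : ℝ) := by
  have hq : 2 ≤ Fintype.card Fq := Fintype.one_lt_card
  obtain ⟨N₀, hN₀⟩ := Filter.eventually_atTop.mp
    (eventually_exp_mul_pow_le_centralBinom (Fintype.card Fq) hq)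
  refine ⟨max N₀ 2, fun N hN => ?_⟩
  have hbound := hN₀ N (le_of_max_le_left hN)
  set q := Fintype.card Fq
  set d := Nat.clog q N
  have hd : 0 < d := Nat.clog_pos hq (le_of_max_le_right hN)
  have hnd : 2 * (N / (2 * d)) * d ≤ N := by
    calc _ = N / (2 * d) * (2 * d) := by ring
      _ ≤ N := Nat.div_mul_le_self _ _
  obtain ⟨A, hdeg, hdiff, hcard⟩ := exists_finset_sub_ne_irreducible_sub_one p Fq d _ N hd.ne'
    (hnd.trans (Nat.le_pow_clog hq N)) hnd
  refine ⟨A, hdeg, hdiff, ?_⟩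
  have hqpos : (0 : ℝ) < (q : ℝ) ^ (d + 1) := by positivity
  have hcardR : ((N / (2 * d)).centralBinom : ℝ) ≤ A.card * (q : ℝ) ^ (d + 1) := by
    exact_mod_cast hcard
  refine le_trans (Real.exp_le_exp.mpr ?_) (le_of_mul_le_mul_right (hbound.trans hcardR) hqpos)
  have hlogq : 0 ≤ Real.log q := Real.log_natCast_nonneg q
  have hlogN : 0 ≤ Real.log N := Real.log_natCast_nonneg N
  gcongr
  linarith
end

section
/- Let B > 0, ε > 0, and let y₁, y₂, y₃ ∈ 𝔽_q[t] be pairwise distinct. There is a constant C = C(q, B, ε, y₁, y₂, y₃) > 0 with the following property. For i = 1, 2, 3 let αᵢ be a complex-valued function on monic polynomials, supported on finitely many squarefree monic polynomials, with |αᵢ(h)| ≤ τ(h)^B/⟨h⟩ for all monic h. For λ ∈ 𝔽_q(t), written in lowest terms with monic denominator r = denom(λ), and for reals X₁, X₂, X₃ > 0, define β(λ) = Σ_{h₁,h₂,h₃ monic} α₁(h₁)α₂(h₂)α₃(h₃) · Σ e(y₁a₁/h₁ + y₂a₂/h₂ + y₃a₃/h₃), where the inner sum is over triples (a₁, a₂,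 a₃) with deg aᵢ < deg hᵢ, gcd(aᵢ, hᵢ) = 1, and a₁/h₁ + a₂/h₂ + a₃/h₃ − λ ∈ 𝔽_q[t]; and define β^trunc(λ) by the same expression with the additional restriction deg hᵢ ≤ Xᵢ for i = 1, 2, 3. Then, with X = min{X₁, X₂, X₃}, we have |β(λ) − β^trunc(λ)| ≤ C · ⟨r⟩^ε · q^{X(ε−1)}. -/
open Polynomial
open scoped Classical

noncomputable section

variable (p : ℕ) [Fact p.Prime] (Fq : Type) [Field Fq] [Fintype Fq] [Algebra (ZMod p) Fq]

/-- `t` as an element of `K∞ = 𝔽_q((1/t))`; the exponent of the Hahn series variable records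
the power of `1/t`, so that `res x = x.coeff 1` and `ord x = -x.order`. -/
def Kt : LaurentSeries Fq := HahnSeries.single (-1 : ℤ) 1

/-- The Laurent expansion at infinity of a polynomial. -/
def toK (f : Polynomial Fq) : LaurentSeries Fq := Polynomial.aeval (Kt Fq) f

/-- The additive character `e(x) = exp(2πi · tr(res x)/p)` on `K∞`. -/
def eC (x : LaurentSeries Fq) : ℂ :=
  Complex.exp (2 * Real.pi * Complex.I *
    ((Algebra.trace (ZMod p) Fq (x.coeff 1)).val : ℂ) / (p : ℂ))

/-- The norm `⟨x⟩ = q^(ord x)` on `K∞` (with `⟨0⟩ = 0`). -/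
def Knorm (x : LaurentSeries Fq) : ℝ :=
  if x = 0 then 0 else (Fintype.card Fq : ℝ) ^ (-x.order)

/-- The norm `⟨f⟩ = q^(deg f)` of a polynomial (with `⟨0⟩ = 0`). -/
def pnorm (f : Polynomial Fq) : ℝ :=
  if f = 0 then 0 else (Fintype.card Fq : ℝ) ^ f.natDegree

/-- The divisor function: the number of monic divisors of `f`. -/
def tauP (f : Polynomial Fq) : ℕ := {d : Polynomial Fq | d.Monic ∧ d ∣ f}.ncard

/-- The `λ`-Fourier coefficient (at `λ = b/r` in lowest terms, `r` monic) of the triple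
correlation `S₁(f+y₁)S₂(f+y₂)S₃(f+y₃)` of three Ramanujan expansions with coefficients
`α₁, α₂, α₃`, where the moduli `hᵢ` are restricted to monic polynomials satisfying `Hᵢ`:
`Σ_{h₁,h₂,h₃} α₁(h₁)α₂(h₂)α₃(h₃) Σ' e(y₁a₁/h₁ + y₂a₂/h₂ + y₃a₃/h₃)`, the inner sum `Σ'`
running over triples `(a₁,a₂,a₃)` with `deg aᵢ < deg hᵢ`, `gcd(aᵢ,hᵢ) = 1` and
`a₁/h₁ + a₂/h₂ + a₃/h₃ − b/r ∈ 𝔽_q[t]`. -/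
def tripleBeta (α₁ α₂ α₃ : Polynomial Fq → ℂ) (y₁ y₂ y₃ b r : Polynomial Fq)
    (H₁ H₂ H₃ : Polynomial Fq → Prop) : ℂ :=
  ∑ᶠ h₁ ∈ {h : Polynomial Fq | h.Monic ∧ H₁ h},
    ∑ᶠ h₂ ∈ {h : Polynomial Fq | h.Monic ∧ H₂ h},
      ∑ᶠ h₃ ∈ {h : Polynomial Fq | h.Monic ∧ H₃ h},
        α₁ h₁ * α₂ h₂ * α₃ h₃ *
          ∑ᶠ a ∈ {a : Polynomial Fq × Polynomial Fq × Polynomial Fq |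
              a.1.degree < h₁.degree ∧ a.2.1.degree < h₂.degree ∧ a.2.2.degree < h₃.degree ∧
              IsCoprime a.1 h₁ ∧ IsCoprime a.2.1 h₂ ∧ IsCoprime a.2.2 h₃ ∧
              ∃ g : Polynomial Fq,
                toK Fq a.1 / toK Fq h₁ + toK Fq a.2.1 / toK Fq h₂ + toK Fq a.2.2 / toK Fq h₃ -
                  toK Fq b / toK Fq r = toK Fq g},
            eC p Fq (toK Fq (y₁ * a.1) / toK Fq h₁ + toK Fq (y₂ * a.2.1) / toK Fq h₂ +
              toK Fq (y₃ * a.2.2) / toK Fq h₃)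

/-! ### Laurent expansions and the additive character -/

section Laurent

variable {F : Type} [Field F] [Algebra (ZMod p) F]

theorem toK_zero : toK F 0 = 0 := map_zero _
theorem toK_add (f g : F[X]) : toK F (f + g) = toK F f + toK F g := map_add _ f g
theorem toK_neg (f : F[X]) : toK F (-f) = -toK F f := map_neg _ f
theorem toK_sub (f g : F[X]) : toK F (f - g) = toK F f - toK F g := map_sub _ f g
theorem toK_mul (f g : F[X]) : toK F (f * g) = toK F f * toK F g := map_mul _ f g

theorem toK_monomial (n : ℕ) (a : F) :
    toK F (monomial n a) = HahnSeries.single (-n : ℤ) a := by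
  have hC : algebraMap F (LaurentSeries F) a = HahnSeries.single 0 a := by
    rw [HahnSeries.algebraMap_apply', PowerSeries.algebraMap_apply, Algebra.algebraMap_self_apply,
      HahnSeries.ofPowerSeries_C, HahnSeries.C_apply]
  rw [toK, aeval_monomial, Kt, HahnSeries.single_pow, one_pow, hC, HahnSeries.single_mul_single]
  simp

theorem toK_coeff (f : F[X]) (m : ℤ) :
    (toK F f).coeff m = if m ≤ 0 then f.coeff (-m).toNat else 0 := by
  induction f using Polynomial.induction_on' with
  | add f g hf hg =>
    rw [toK_add, HahnSeries.coeff_add, hf, hg]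
    split_ifs <;> simp
  | monomial n a =>
    rw [toK_monomial, HahnSeries.coeff_single, coeff_monomial]
    split_ifs <;> first | rfl | omega

theorem toK_injective : Function.Injective (toK F) := by
  intro f g h
  ext n
  have := congrArg (fun x : LaurentSeries F => x.coeff (-n : ℤ)) h
  simpa [toK_coeff] using this

theorem toK_ne_zero {f : F[X]} (hf : f ≠ 0) : toK F f ≠ 0 := fun h =>
  hf (toK_injective (h.trans toK_zero.symm))

theorem toK_order {f : F[X]} (hf : f ≠ 0) : (toK F f).order = -(f.natDegree : ℤ) := by
  apply le_antisymm
  · apply HahnSeries.order_le_of_coeff_ne_zero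
    simpa [toK_coeff] using hf
  · by_contra! h
    apply HahnSeries.coeff_order_eq_zero.not.2 (toK_ne_zero hf)
    rw [toK_coeff, if_pos (by omega)]
    apply coeff_eq_zero_of_natDegree_lt
    omega

theorem toK_leadingCoeff {f : F[X]} (hf : f ≠ 0) :
    (toK F f).leadingCoeff = f.leadingCoeff := by
  rw [HahnSeries.leadingCoeff_eq, toK_order hf, toK_coeff]
  simp

/-- The residue of `f / k` when `deg f = deg k - 1`. -/
theorem coeff_one_toK_div {f k : F[X]} (hf : f ≠ 0) (hk : k ≠ 0)
    (h : f.natDegree + 1 = k.natDegree) :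
    (toK F f / toK F k).coeff 1 = f.leadingCoeff / k.leadingCoeff := by
  set x := toK F f / toK F k with hx
  have hk' := toK_ne_zero hk
  have hxk : x * toK F k = toK F f := div_mul_cancel₀ _ hk'
  have hx0 : x ≠ 0 := div_ne_zero (toK_ne_zero hf) hk'
  have ho : x.order = 1 := by
    have := HahnSeries.order_mul hx0 hk'
    rw [hxk, toK_order hf, toK_order hk] at this
    omega
  have hl := HahnSeries.leadingCoeff_mul x (toK F k)
  rw [hxk, toK_leadingCoeff hf, toK_leadingCoeff hk, HahnSeries.leadingCoeff_eq, ho] at hl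
  rw [hl, mul_div_cancel_right₀ _ (leadingCoeff_ne_zero.2 hk)]

theorem eC_eq_stdAddChar (x : LaurentSeries F) :
    eC p F x = ZMod.stdAddChar (Algebra.trace (ZMod p) F (x.coeff 1)) := by
  rw [ZMod.stdAddChar_apply, ZMod.toCircle_apply, eC]

theorem eC_add (x y : LaurentSeries F) : eC p F (x + y) = eC p F x * eC p F y := by
  simp only [eC_eq_stdAddChar, HahnSeries.coeff_add, map_add, AddChar.map_add_eq_mul]

theorem norm_eC (x : LaurentSeries F) : ‖eC p F x‖ = 1 := by
  rw [eC_eq_stdAddChar, ZMod.stdAddChar_apply, Circle.norm_coe]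

theorem eC_ne_one {x : LaurentSeries F} (hx : Algebra.trace (ZMod p) F (x.coeff 1) ≠ 0) :
    eC p F x ≠ 1 := by
  rw [eC_eq_stdAddChar, ← AddChar.map_zero_eq_one (ZMod.stdAddChar (N := p))]
  exact fun h => hx (ZMod.injective_stdAddChar h)

theorem eC_toK (f : F[X]) : eC p F (toK F f) = 1 := by
  rw [eC_eq_stdAddChar, toK_coeff]
  simp

/-- The characters `c ↦ e(f c / k)` of the residues modulo `k` are nontrivial unless `k ∣ f`. -/
theorem exists_eC_mul_div_ne_one [Finite F] {f k : F[X]} (hk : k ≠ 0) (hfk : ¬ k ∣ f) :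
    ∃ c : F[X], c.degree < k.degree ∧ eC p F (toK F (f * c) / toK F k) ≠ 1 := by
  have : Module.Finite (ZMod p) F := Module.Finite.of_finite
  set g := f % k with hg
  have hg0 : g ≠ 0 := fun h => hfk (EuclideanDomain.mod_eq_zero.1 h)
  have hdeg : g.degree < k.degree := EuclideanDomain.mod_lt f hk
  have hnat : g.natDegree < k.natDegree := natDegree_lt_natDegree hg0 hdeg
  obtain ⟨s, hs⟩ := Algebra.trace_surjective (ZMod p) F 1
  have hs0 : s ≠ 0 := by
    rintro rfl
    simp at hs
  set z := s * k.leadingCoeff / g.leadingCoeff with hz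
  have hk1 := leadingCoeff_ne_zero.2 hk
  have hg1 := leadingCoeff_ne_zero.2 hg0
  have hz0 : z ≠ 0 := div_ne_zero (mul_ne_zero hs0 hk1) hg1
  have hc0 : monomial (k.natDegree - 1 - g.natDegree) z ≠ 0 := by simpa using hz0
  refine ⟨monomial (k.natDegree - 1 - g.natDegree) z, ?_, ?_⟩
  · apply degree_lt_degree
    rw [natDegree_monomial, if_neg hz0]
    omega
  · set c := monomial (k.natDegree - 1 - g.natDegree) z with hc
    have hsplit : toK F (f * c) / toK F k =
        toK F (f / k * c) + toK F (g * c) / toK F k := by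
      have h1 : f * c = k * (f / k * c) + g * c := by
        conv_lhs => rw [← EuclideanDomain.div_add_mod f k]
        ring
      rw [h1, toK_add, add_div, toK_mul k, mul_div_cancel_left₀ _ (toK_ne_zero hk)]
    rw [hsplit, eC_add, eC_toK, one_mul]
    apply eC_ne_one
    rw [coeff_one_toK_div (mul_ne_zero hg0 hc0) hk, leadingCoeff_mul, hc, leadingCoeff_monomial,
      hz, mul_div_cancel₀ _ hg1, mul_div_cancel_right₀ _ hk1, hs]
    · exact one_ne_zero
    · rw [natDegree_mul hg0 hc0, hc, natDegree_monomial, if_neg hz0]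
      omega

end Laurent

/-! ### Exponential sums over congruence-restricted triples -/

section ExponentialSum

variable {F : Type} [Field F]

theorem ncard_degree_lt [Fintype F] (n : ℕ) :
    {f : F[X] | f.degree < n}.ncard = Fintype.card F ^ n := by
  have h : {f : F[X] | f.degree < n} = (degreeLT F n : Set F[X]) := by
    ext f
    simp [mem_degreeLT]
  rw [h, ← Nat.card_coe_set_eq]
  have := Nat.card_congr (degreeLTEquiv F n).toEquiv
  simpa using this

theorem finite_degree_lt [Finite F] (n : ℕ) : {f : F[X] | f.degree < n}.Finite := by
  have := Fintype.ofFinite F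
  apply Set.finite_of_ncard_pos
  rw [ncard_degree_lt]
  exact pow_pos Fintype.card_pos n

theorem exists_eq_mul_isCoprime (a : F[X]) {b : F[X]} (hb : b ≠ 0) :
    ∃ g u v : F[X], a = g * u ∧ b = g * v ∧ IsCoprime u v := by
  let _ := EuclideanDomain.gcdMonoid F[X]
  have hg : gcd a b ≠ 0 := fun h => hb ((gcd_eq_zero_iff a b).1 h).2
  exact ⟨gcd a b, a / gcd a b, b / gcd a b,
    (EuclideanDomain.mul_div_cancel' hg (gcd_dvd_left a b)).symm,
    (EuclideanDomain.mul_div_cancel' hg (gcd_dvd_right a b)).symm, isCoprime_div_gcd_div_gcd hb⟩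

theorem dvd_mul_of_dvd_mul_of_isCoprime {g u v w : F[X]} (hg : g ≠ 0) (huv : IsCoprime u v)
    (h : g * u ∣ w * (g * v)) : g * u ∣ w * g := by
  rw [mul_left_comm, mul_dvd_mul_iff_left hg] at h
  rw [mul_comm w]
  exact mul_dvd_mul_left g (huv.dvd_of_dvd_mul_right h)

/-- Clearing denominators in a congruence between fractions. -/
theorem dvd_mul_mul_of_toK {w₁ w₂ w₃ k₁ k₂ k₃ g : F[X]} (h₁ : k₁ ≠ 0) (h₂ : k₂ ≠ 0) (h₃ : k₃ ≠ 0)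
    (h : toK F w₁ / toK F k₁ + toK F w₂ / toK F k₂ + toK F w₃ / toK F k₃ = toK F g) :
    k₁ ∣ w₁ * k₂ * k₃ := by
  have e₁ := toK_ne_zero h₁
  have e₂ := toK_ne_zero h₂
  have e₃ := toK_ne_zero h₃
  have : w₁ * k₂ * k₃ = k₁ * (g * k₂ * k₃ - w₂ * k₃ - w₃ * k₂) := by
    apply toK_injective
    simp only [toK_mul, toK_sub, ← h]
    field_simp
    ring
  exact ⟨_, this⟩

theorem sum_eq_zero_of_translate {V : Type*} [AddCommGroup V] (P : Finset V) (χ : V → ℂ) (v : V)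
    (hχ : ∀ a, χ (v + a) = χ v * χ a) (hP : ∀ a ∈ P, v + a ∈ P) (hv : χ v ≠ 1) :
    ∑ a ∈ P, χ a = 0 := by
  have hmap : P.map (addLeftEmbedding v) = P := by
    apply Finset.eq_of_subset_of_card_le
    · intro x hx
      obtain ⟨a, ha, rfl⟩ := Finset.mem_map.1 hx
      exact hP a ha
    · rw [Finset.card_map]
  have h : ∑ a ∈ P, χ a = χ v * ∑ a ∈ P, χ a := by
    conv_lhs => rw [← hmap]
    rw [Finset.sum_map, Finset.mul_sum]
    exact Finset.sum_congr rfl fun a _ => hχ a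
  have h' : (1 - χ v) * ∑ a ∈ P, χ a = 0 := by
    rw [sub_mul, one_mul, ← h, sub_self]
  exact (mul_eq_zero.1 h').resolve_left (sub_ne_zero.2 hv.symm)

/-- The phase attached to a triple of numerators. -/
def phase (y₁ y₂ y₃ h₁ h₂ h₃ : F[X]) (a : F[X] × F[X] × F[X]) : LaurentSeries F :=
  toK F (y₁ * a.1) / toK F h₁ + toK F (y₂ * a.2.1) / toK F h₂ + toK F (y₃ * a.2.2) / toK F h₃

theorem phase_add (y₁ y₂ y₃ h₁ h₂ h₃ : F[X]) (a b : F[X] × F[X] × F[X]) :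
    phase y₁ y₂ y₃ h₁ h₂ h₃ (a + b) = phase y₁ y₂ y₃ h₁ h₂ h₃ a + phase y₁ y₂ y₃ h₁ h₂ h₃ b := by
  simp only [phase, Prod.fst_add, Prod.snd_add, mul_add, toK_add, add_div]
  ring

/-- If the characters induced on a pair of denominators are nontrivial, there is a translation
witnessing the cancellation. -/
theorem exists_pair_translate [Finite F] [Algebra (ZMod p) F] {y z d e g u v : F[X]}
    (hd : d ≠ 0) (he : e ≠ 0) (hg : g ≠ 0) (hu : u ≠ 0) (hv : v ≠ 0)
    (hyz : ¬ g ∣ y - z) :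
    ∃ s t : F[X], s.degree < (d * (g * u)).degree ∧ t.degree < (e * (g * v)).degree ∧
      d ∣ s ∧ e ∣ t ∧ toK F s / toK F (d * (g * u)) + toK F t / toK F (e * (g * v)) = 0 ∧
      eC p F (toK F (y * s) / toK F (d * (g * u)) + toK F (z * t) / toK F (e * (g * v))) ≠ 1 := by
  obtain ⟨c, hc, hc1⟩ := exists_eC_mul_div_ne_one p hg hyz
  have e₁ := toK_ne_zero hd
  have e₂ := toK_ne_zero he
  have e₃ := toK_ne_zero hg
  have e₄ := toK_ne_zero hu
  have e₅ := toK_ne_zero hv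
  have key : ∀ {a b : F[X]}, a ≠ 0 → b ≠ 0 → (a * (c * b)).degree < (a * (g * b)).degree := by
    intro a b ha hb
    rw [mul_left_comm, mul_left_comm a g b]
    rw [degree_mul (p := c), degree_mul (p := g)]
    have hab : (a * b).degree ≠ ⊥ := degree_ne_bot.2 (mul_ne_zero ha hb)
    exact WithBot.add_lt_add_right hab hc
  refine ⟨d * (c * u), -(e * (c * v)), key hd hu, ?_, dvd_mul_right _ _,
    (dvd_mul_right _ _).neg_right, ?_, ?_⟩
  · rw [degree_neg]
    exact key he hv
  · simp only [toK_mul, toK_neg]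
    field_simp
    ring
  · convert hc1 using 2
    simp only [toK_mul, toK_neg, toK_sub]
    field_simp
    ring

/-- The box of numerators, restricted to multiples of `d₁, d₂, d₃` and to a fixed value of
`a₁/h₁ + a₂/h₂ + a₃/h₃` modulo polynomials. -/
structure IsAdmissible (h₁ h₂ h₃ d₁ d₂ d₃ : F[X]) (x : LaurentSeries F) (a : F[X] × F[X] × F[X]) :
    Prop where
  degree₁ : a.1.degree < h₁.degree
  degree₂ : a.2.1.degree < h₂.degree
  degree₃ : a.2.2.degree < h₃.degree
  dvd₁ : d₁ ∣ a.1
  dvd₂ : d₂ ∣ a.2.1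
  dvd₃ : d₃ ∣ a.2.2
  congr : ∃ g : F[X], toK F a.1 / toK F h₁ + toK F a.2.1 / toK F h₂ + toK F a.2.2 / toK F h₃ - x =
    toK F g

theorem IsAdmissible.add {h₁ h₂ h₃ d₁ d₂ d₃ : F[X]} {x y : LaurentSeries F}
    {a b : F[X] × F[X] × F[X]} (ha : IsAdmissible h₁ h₂ h₃ d₁ d₂ d₃ x a)
    (hb : IsAdmissible h₁ h₂ h₃ d₁ d₂ d₃ y b) :
    IsAdmissible h₁ h₂ h₃ d₁ d₂ d₃ (x + y) (a + b) where
  degree₁ := (degree_add_le _ _).trans_lt (max_lt ha.1 hb.1)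
  degree₂ := (degree_add_le _ _).trans_lt (max_lt ha.2 hb.2)
  degree₃ := (degree_add_le _ _).trans_lt (max_lt ha.3 hb.3)
  dvd₁ := dvd_add ha.4 hb.4
  dvd₂ := dvd_add ha.5 hb.5
  dvd₃ := dvd_add ha.6 hb.6
  congr := by
    obtain ⟨g, hg⟩ := ha.congr
    obtain ⟨g', hg'⟩ := hb.congr
    refine ⟨g + g', ?_⟩
    rw [toK_add, ← hg, ← hg']
    simp only [Prod.fst_add, Prod.snd_add, toK_add, add_div]
    ring

theorem IsAdmissible.neg {h₁ h₂ h₃ d₁ d₂ d₃ : F[X]} {x : LaurentSeries F}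
    {a : F[X] × F[X] × F[X]} (ha : IsAdmissible h₁ h₂ h₃ d₁ d₂ d₃ x a) :
    IsAdmissible h₁ h₂ h₃ d₁ d₂ d₃ (-x) (-a) where
  degree₁ := by simpa using ha.1
  degree₂ := by simpa using ha.2
  degree₃ := by simpa using ha.3
  dvd₁ := ha.4.neg_right
  dvd₂ := ha.5.neg_right
  dvd₃ := ha.6.neg_right
  congr := by
    obtain ⟨g, hg⟩ := ha.congr
    refine ⟨-g, ?_⟩
    rw [toK_neg, ← hg]
    simp only [Prod.fst_neg, Prod.snd_neg, toK_neg, neg_div]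
    ring

theorem finite_isAdmissible [Finite F] {h₁ h₂ h₃ : F[X]} (e₁ : h₁ ≠ 0) (e₂ : h₂ ≠ 0) (e₃ : h₃ ≠ 0)
    (d₁ d₂ d₃ : F[X]) (x : LaurentSeries F) :
    {a | IsAdmissible h₁ h₂ h₃ d₁ d₂ d₃ x a}.Finite := by
  apply ((finite_degree_lt (F := F) h₁.natDegree).prod
    ((finite_degree_lt h₂.natDegree).prod (finite_degree_lt h₃.natDegree))).subset
  intro a ha
  simp only [Set.mem_prod, Set.mem_ofPred_eq, ← degree_eq_natDegree e₁, ← degree_eq_natDegree e₂,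
    ← degree_eq_natDegree e₃]
  exact ⟨ha.1, ha.2, ha.3⟩

theorem norm_sum_isAdmissible_le [Fintype F] [Algebra (ZMod p) F]
    {y₁ y₂ y₃ h₁ h₂ h₃ d₁ d₂ d₃ : F[X]}
    (hy12 : y₁ ≠ y₂) (hy13 : y₁ ≠ y₃) (hy23 : y₂ ≠ y₃)
    (e₁ : h₁ ≠ 0) (e₂ : h₂ ≠ 0) (e₃ : h₃ ≠ 0) (hd₁ : d₁ ∣ h₁) (hd₂ : d₂ ∣ h₂) (hd₃ : d₃ ∣ h₃)
    (x : LaurentSeries F) (P : Finset (F[X] × F[X] × F[X]))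
    (hP : ∀ a, a ∈ P ↔ IsAdmissible h₁ h₂ h₃ d₁ d₂ d₃ x a) :
    ‖∑ a ∈ P, eC p F (phase y₁ y₂ y₃ h₁ h₂ h₃ a)‖ ≤
      ((Fintype.card F ^ ((y₁ - y₂) * (y₁ - y₃) * (y₂ - y₃)).natDegree) ^ 3 : ℕ) := by
  obtain ⟨k₁, rfl⟩ := hd₁
  obtain ⟨k₂, rfl⟩ := hd₂
  obtain ⟨k₃, rfl⟩ := hd₃
  obtain ⟨hd₁, hk₁⟩ := mul_ne_zero_iff.1 e₁
  obtain ⟨hd₂, hk₂⟩ := mul_ne_zero_iff.1 e₂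
  obtain ⟨hd₃, hk₃⟩ := mul_ne_zero_iff.1 e₃
  have hzero : ∀ v, IsAdmissible (d₁ * k₁) (d₂ * k₂) (d₃ * k₃) d₁ d₂ d₃ 0 v →
      eC p F (phase y₁ y₂ y₃ (d₁ * k₁) (d₂ * k₂) (d₃ * k₃) v) ≠ 1 →
      ‖∑ a ∈ P, eC p F (phase y₁ y₂ y₃ (d₁ * k₁) (d₂ * k₂) (d₃ * k₃) a)‖ ≤
      ((Fintype.card F ^ ((y₁ - y₂) * (y₁ - y₃) * (y₂ - y₃)).natDegree) ^ 3 : ℕ) := by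
    intro v hv hv1
    rw [sum_eq_zero_of_translate P _ v _ _ hv1, norm_zero]
    · positivity
    · intro a
      rw [phase_add, eC_add]
    · intro a ha
      rw [hP] at ha ⊢
      simpa using hv.add ha
  have hlt : ∀ {h : F[X]}, h ≠ 0 → (0 : F[X]).degree < h.degree := fun h => by
    rw [degree_zero]
    exact bot_lt_iff_ne_bot.2 (degree_ne_bot.2 h)
  obtain ⟨g, u, v, hgu, hgv, huv⟩ := exists_eq_mul_isCoprime k₁ hk₂
  obtain ⟨g', u', v', hgu', hgv', huv'⟩ := exists_eq_mul_isCoprime k₁ hk₃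
  obtain ⟨g'', u'', v'', hgu'', hgv'', huv''⟩ := exists_eq_mul_isCoprime k₂ hk₃
  obtain ⟨hg0, hu0⟩ := mul_ne_zero_iff.1 (hgu ▸ hk₁)
  obtain ⟨hg0', hu0'⟩ := mul_ne_zero_iff.1 (hgu' ▸ hk₁)
  obtain ⟨hg0'', hu0''⟩ := mul_ne_zero_iff.1 (hgu'' ▸ hk₂)
  have hv0 := (mul_ne_zero_iff.1 (hgv ▸ hk₂)).2
  have hv0' := (mul_ne_zero_iff.1 (hgv' ▸ hk₃)).2
  have hv0'' := (mul_ne_zero_iff.1 (hgv'' ▸ hk₃)).2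
  by_cases c12 : g ∣ y₁ - y₂
  swap
  · obtain ⟨s, t, hs, ht, ds, dt, hst, hne⟩ :=
      exists_pair_translate p hd₁ hd₂ hg0 hu0 hv0 c12
    rw [← hgu, ← hgv] at hst hne
    rw [← hgu] at hs
    rw [← hgv] at ht
    refine hzero (s, t, 0) ⟨hs, ht, hlt e₃, ds, dt, dvd_zero _, 0, ?_⟩ ?_
    · simp [hst, toK_zero]
    · simpa [phase, toK_zero] using hne
  by_cases c13 : g' ∣ y₁ - y₃
  swap
  · obtain ⟨s, t, hs, ht, ds, dt, hst, hne⟩ :=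
      exists_pair_translate p hd₁ hd₃ hg0' hu0' hv0' c13
    rw [← hgu', ← hgv'] at hst hne
    rw [← hgu'] at hs
    rw [← hgv'] at ht
    refine hzero (s, 0, t) ⟨hs, hlt e₂, ht, ds, dvd_zero _, dt, 0, ?_⟩ ?_
    · simp [hst, toK_zero]
    · simpa [phase, toK_zero] using hne
  by_cases c23 : g'' ∣ y₂ - y₃
  swap
  · obtain ⟨s, t, hs, ht, ds, dt, hst, hne⟩ :=
      exists_pair_translate p hd₂ hd₃ hg0'' hu0'' hv0'' c23
    rw [← hgu'', ← hgv''] at hst hne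
    rw [← hgu''] at hs
    rw [← hgv''] at ht
    refine hzero (0, s, t) ⟨hlt e₁, hs, ht, dvd_zero _, ds, dt, 0, ?_⟩ ?_
    · simp [hst, toK_zero]
    · simpa [phase, toK_zero] using hne
  set D := (y₁ - y₂) * (y₁ - y₃) * (y₂ - y₃) with hD
  have hD0 : D ≠ 0 := mul_ne_zero (mul_ne_zero (sub_ne_zero.2 hy12) (sub_ne_zero.2 hy13))
    (sub_ne_zero.2 hy23)
  have hhom : ∀ w, IsAdmissible (d₁ * k₁) (d₂ * k₂) (d₃ * k₃) d₁ d₂ d₃ 0 w →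
      d₁ * k₁ ∣ w.1 * D ∧ d₂ * k₂ ∣ w.2.1 * D ∧ d₃ * k₃ ∣ w.2.2 * D := by
    rintro ⟨w₁, w₂, w₃⟩ hw
    obtain ⟨⟨w₁, rfl⟩, ⟨w₂, rfl⟩, ⟨w₃, rfl⟩⟩ := And.intro hw.dvd₁ (And.intro hw.dvd₂ hw.dvd₃)
    obtain ⟨m, hm⟩ := hw.congr
    simp only [toK_mul, mul_div_mul_left _ _ (toK_ne_zero hd₁),
      mul_div_mul_left _ _ (toK_ne_zero hd₂), mul_div_mul_left _ _ (toK_ne_zero hd₃), sub_zero] at hm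
    have q₁ := dvd_mul_mul_of_toK hk₁ hk₂ hk₃ hm
    have q₂ : k₂ ∣ w₂ * k₁ * k₃ :=
      dvd_mul_mul_of_toK hk₂ hk₁ hk₃ (w₂ := w₁) (w₃ := w₃) (g := m) (by rw [← hm]; ring)
    have q₃ : k₃ ∣ w₃ * k₁ * k₂ :=
      dvd_mul_mul_of_toK hk₃ hk₁ hk₂ (w₂ := w₁) (w₃ := w₂) (g := m) (by rw [← hm]; ring)
    simp only [mul_assoc d₁, mul_assoc d₂, mul_assoc d₃]
    refine ⟨mul_dvd_mul_left _ ?_, mul_dvd_mul_left _ ?_, mul_dvd_mul_left _ ?_⟩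
    · have r₁ : k₁ ∣ w₁ * k₂ * g' := by
        rw [hgu']
        apply dvd_mul_of_dvd_mul_of_isCoprime hg0' huv'
        rwa [← hgu', ← hgv']
      have r₂ : k₁ ∣ w₁ * g' * g := by
        rw [hgu]
        apply dvd_mul_of_dvd_mul_of_isCoprime hg0 huv
        rw [← hgu, ← hgv]
        convert r₁ using 1
        ring
      refine r₂.trans ?_
      rw [mul_assoc]
      apply mul_dvd_mul_left
      rw [mul_comm g', hD]
      exact (mul_dvd_mul c12 c13).mul_right _
    · have r₁ : k₂ ∣ w₂ * k₁ * g'' := by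
        rw [hgu'']
        apply dvd_mul_of_dvd_mul_of_isCoprime hg0'' huv''
        rwa [← hgu'', ← hgv'']
      have r₂ : k₂ ∣ w₂ * g'' * g := by
        rw [hgv]
        apply dvd_mul_of_dvd_mul_of_isCoprime hg0 huv.symm
        rw [← hgu, ← hgv]
        convert r₁ using 1
        ring
      refine r₂.trans ?_
      rw [mul_assoc]
      apply mul_dvd_mul_left
      rw [mul_comm g'', hD, mul_right_comm]
      exact (mul_dvd_mul c12 c23).mul_right _
    · have r₁ : k₃ ∣ w₃ * k₁ * g'' := by
        rw [hgv'']
        apply dvd_mul_of_dvd_mul_of_isCoprime hg0'' huv''.symm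
        rwa [← hgu'', ← hgv'']
      have r₂ : k₃ ∣ w₃ * g'' * g' := by
        rw [hgv']
        apply dvd_mul_of_dvd_mul_of_isCoprime hg0' huv'.symm
        rw [← hgu', ← hgv']
        convert r₁ using 1
        ring
      refine r₂.trans ?_
      rw [mul_assoc]
      apply mul_dvd_mul_left
      rw [mul_comm g'', hD, mul_assoc (y₁ - y₂)]
      exact (mul_dvd_mul c13 c23).mul_left _
  have hcard : P.card ≤ (Fintype.card F ^ D.natDegree) ^ 3 := by
    rcases P.eq_empty_or_nonempty with rfl | ⟨b, hb⟩
    · simp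
    set box : Finset F[X] := (finite_degree_lt (F := F) D.natDegree).toFinset with hbox
    have hbc : box.card = Fintype.card F ^ D.natDegree := by
      rw [← ncard_degree_lt, Set.ncard_eq_toFinset_card _ (finite_degree_lt D.natDegree)]
    have hmem : ∀ {h w : F[X]}, h ≠ 0 → w.degree < h.degree → h ∣ w * D → w * D / h ∈ box := by
      intro h w h0 hw hdvd
      rw [hbox, Set.Finite.mem_toFinset, Set.mem_ofPred_eq, ← degree_eq_natDegree hD0]
      have h1 := EuclideanDomain.mul_div_cancel' h0 hdvd
      have h2 : (h * (w * D / h)).degree < (h * D).degree := by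
        rw [h1, degree_mul (p := w), degree_mul (p := h)]
        exact WithBot.add_lt_add_right (degree_ne_bot.2 hD0) hw
      rw [degree_mul, degree_mul] at h2
      exact lt_of_add_lt_add_left h2
    have hdiff : ∀ a ∈ P, IsAdmissible (d₁ * k₁) (d₂ * k₂) (d₃ * k₃) d₁ d₂ d₃ 0 (a - b) := by
      intro a ha
      have := ((hP a).1 ha).add ((hP b).1 hb).neg
      rwa [add_neg_cancel, ← sub_eq_add_neg] at this
    have hcancel : ∀ {h w w' z : F[X]}, h ≠ 0 → h ∣ (w - z) * D → h ∣ (w' - z) * D →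
        (w - z) * D / h = (w' - z) * D / h → w = w' := by
      intro h w w' z h0 hw hw' he
      have h1 := EuclideanDomain.mul_div_cancel' h0 hw
      rw [he, EuclideanDomain.mul_div_cancel' h0 hw'] at h1
      exact (sub_left_injective (mul_right_cancel₀ hD0 h1)).symm
    calc P.card ≤ (box ×ˢ box ×ˢ box).card := by
          apply Finset.card_le_card_of_injOn (fun a : F[X] × F[X] × F[X] =>
            ((a.1 - b.1) * D / (d₁ * k₁), (a.2.1 - b.2.1) * D / (d₂ * k₂),
              (a.2.2 - b.2.2) * D / (d₃ * k₃)))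
          · intro a ha
            have h := hdiff a ha
            obtain ⟨h1, h2, h3⟩ := hhom _ h
            simp only [Finset.coe_product, Set.mem_prod, Finset.mem_coe]
            exact ⟨hmem e₁ h.1 h1, hmem e₂ h.2 h2, hmem e₃ h.3 h3⟩
          · intro a ha a' ha' haa
            obtain ⟨h1, h2, h3⟩ := hhom _ (hdiff a ha)
            obtain ⟨h1', h2', h3'⟩ := hhom _ (hdiff a' ha')
            simp only [Prod.mk.injEq] at haa
            exact Prod.ext (hcancel e₁ h1 h1' haa.1)
              (Prod.ext (hcancel e₂ h2 h2' haa.2.1) (hcancel e₃ h3 h3' haa.2.2))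
      _ = _ := by
          rw [Finset.card_product, Finset.card_product, hbc]
          ring
  calc ‖∑ a ∈ P, eC p F (phase y₁ y₂ y₃ (d₁ * k₁) (d₂ * k₂) (d₃ * k₃) a)‖
      ≤ ∑ a ∈ P, (1 : ℝ) := norm_sum_le_of_le _ fun a _ => (norm_eC p _).le
    _ = (P.card : ℝ) := by simp
    _ ≤ _ := by exact_mod_cast hcard

end ExponentialSum

/-! ### The divisor function and Möbius inversion -/

section Divisors

variable {F : Type} [Field F]

theorem finite_monic_dvd [Finite F] {f : F[X]} (hf : f ≠ 0) :
    {d : F[X] | d.Monic ∧ d ∣ f}.Finite := by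
  apply (finite_degree_lt (F := F) (f.natDegree + 1)).subset
  rintro d ⟨-, hd⟩
  apply (degree_le_of_dvd hd hf).trans_lt
  rw [degree_eq_natDegree hf]
  exact_mod_cast Nat.lt_succ_self _

theorem one_le_tauP [Finite F] {f : F[X]} (hf : f ≠ 0) : 1 ≤ tauP F f :=
  (Set.ncard_pos (finite_monic_dvd hf)).2 ⟨1, monic_one, one_dvd f⟩

theorem tauP_mul_le [Finite F] {f g : F[X]} (hf : f ≠ 0) (hg : g ≠ 0) :
    tauP F (f * g) ≤ tauP F f * tauP F g := by
  rw [tauP, tauP, tauP, ← Set.ncard_prod]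
  refine (Set.ncard_le_ncard ?_ (((finite_monic_dvd hf).prod (finite_monic_dvd hg)).image
    (fun x : F[X] × F[X] => x.1 * x.2))).trans
    (Set.ncard_image_le ((finite_monic_dvd hf).prod (finite_monic_dvd hg)))
  rintro d ⟨hd, hdvd⟩
  obtain ⟨a, b, ha, hb, rfl⟩ := exists_dvd_and_dvd_of_dvd_mul hdvd
  have ha0 := ne_zero_of_dvd_ne_zero hf ha
  have hb0 := ne_zero_of_dvd_ne_zero hg hb
  refine ⟨(normalize a, normalize b), ⟨⟨monic_normalize ha0, normalize_dvd_iff.2 ha⟩,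
    ⟨monic_normalize hb0, normalize_dvd_iff.2 hb⟩⟩, ?_⟩
  change normalize a * normalize b = a * b
  rw [← normalize_mul, hd.normalize_eq_self]

theorem tauP_prime_pow_le {π : F[X]} (hπ : Prime π) (v : ℕ) : tauP F (π ^ v) ≤ v + 1 := by
  have : {d : F[X] | d.Monic ∧ d ∣ π ^ v} ⊆
      (((Finset.range (v + 1)).image fun i => normalize (π ^ i) : Finset F[X]) : Set F[X]) := by
    rintro d ⟨hd, hdvd⟩
    obtain ⟨i, hi, h⟩ := (dvd_prime_pow hπ v).1 hdvd
    rw [Finset.coe_image]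
    refine ⟨i, by simpa using Nat.lt_succ_of_le hi, ?_⟩
    rw [← hd.normalize_eq_self]
    exact (normalize_eq_normalize_iff_associated.2 h).symm
  calc tauP F (π ^ v) ≤ _ := Set.ncard_le_ncard this (Finset.finite_toSet _)
    _ = _ := Set.ncard_coe_finset _
    _ ≤ v + 1 := by simpa using Finset.card_image_le (s := Finset.range (v + 1))

theorem tauP_of_isUnit {f : F[X]} (hf : IsUnit f) : tauP F f = 1 := by
  have : {d : F[X] | d.Monic ∧ d ∣ f} = {1} := by
    ext d
    refine ⟨fun ⟨h, h'⟩ => h.eq_one_of_isUnit (isUnit_of_dvd_unit h' hf), ?_⟩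
    rintro rfl
    exact ⟨monic_one, one_dvd f⟩
  rw [tauP, this, Set.ncard_singleton]

theorem pnorm_eq [Fintype F] {f : F[X]} (hf : f ≠ 0) :
    pnorm F f = (Fintype.card F : ℝ) ^ f.natDegree := if_neg hf

theorem one_lt_card_real [Fintype F] : (1 : ℝ) < Fintype.card F := by
  exact_mod_cast Fintype.one_lt_card

theorem pnorm_mul [Fintype F] {f g : F[X]} (hf : f ≠ 0) (hg : g ≠ 0) :
    pnorm F (f * g) = pnorm F f * pnorm F g := by
  rw [pnorm_eq hf, pnorm_eq hg, pnorm_eq (mul_ne_zero hf hg), natDegree_mul hf hg, pow_add]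

theorem one_le_pnorm [Fintype F] {f : F[X]} (hf : f ≠ 0) : 1 ≤ pnorm F f := by
  rw [pnorm_eq hf]
  exact one_le_pow₀ one_lt_card_real.le

theorem pnorm_pos [Fintype F] {f : F[X]} (hf : f ≠ 0) : 0 < pnorm F f :=
  one_pos.trans_le (one_le_pnorm hf)

theorem pnorm_mul_rpow [Fintype F] {f g : F[X]} (hf : f ≠ 0) (hg : g ≠ 0) (s : ℝ) :
    pnorm F (f * g) ^ s = pnorm F f ^ s * pnorm F g ^ s := by
  rw [pnorm_mul hf hg, Real.mul_rpow (pnorm_pos hf).le (pnorm_pos hg).le]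

theorem tauP_le_of_large_primes [Fintype F] {δ : ℝ} {D : ℕ}
    (hD : 2 ≤ ((Fintype.card F : ℝ) ^ D) ^ δ) (hδ : 0 ≤ δ) (f : F[X]) (hf : f ≠ 0)
    (h : ∀ π : F[X], Prime π → π ∣ f → D ≤ π.natDegree) : (tauP F f : ℝ) ≤ pnorm F f ^ δ := by
  induction f using UniqueFactorizationMonoid.induction_on_prime with
  | h₁ => exact absurd rfl hf
  | h₂ f hu =>
    rw [tauP_of_isUnit hu, Nat.cast_one]
    exact Real.one_le_rpow (one_le_pnorm hf) hδ
  | h₃ f π hf0 hπ ih =>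
    have ih := ih hf0 fun σ hσ hd => h σ hσ (hd.mul_left _)
    have h1 : (2 : ℝ) ≤ pnorm F π ^ δ := by
      refine hD.trans (Real.rpow_le_rpow (by positivity) ?_ hδ)
      rw [pnorm_eq hπ.ne_zero]
      exact pow_le_pow_right₀ one_lt_card_real.le (h π hπ (dvd_mul_right _ _))
    have h2 : tauP F π ≤ 2 := by simpa using tauP_prime_pow_le hπ 1
    calc (tauP F (π * f) : ℝ) ≤ tauP F π * tauP F f := by
          exact_mod_cast tauP_mul_le hπ.ne_zero hf0
      _ ≤ 2 * tauP F f := by gcongr; exact_mod_cast h2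
      _ ≤ pnorm F π ^ δ * pnorm F f ^ δ := by gcongr
      _ = _ := (pnorm_mul_rpow hπ.ne_zero hf0 δ).symm

theorem tauP_le_of_small_primes_mem [Fintype F] {δ : ℝ} {D : ℕ}
    (hD : 2 ≤ ((Fintype.card F : ℝ) ^ D) ^ δ) (hδ : 0 ≤ δ) (S : Finset F[X]) (f : F[X])
    (hf : f ≠ 0) (h : ∀ π : F[X], Prime π → π ∣ f → π ∈ S ∨ D ≤ π.natDegree) :
    (tauP F f : ℝ) ≤ (f.natDegree + 1) ^ S.card * pnorm F f ^ δ := by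
  induction S using Finset.induction_on generalizing f with
  | empty => simpa using tauP_le_of_large_primes hD hδ f hf (by simpa using h)
  | insert π S hπS ih =>
    rw [Finset.card_insert_of_notMem hπS]
    by_cases hπ : Prime π
    swap
    · refine (ih f hf fun σ hσ hd => ?_).trans ?_
      · have := h σ hσ hd
        rw [Finset.mem_insert] at this
        rcases this with (rfl | h) | h
        · exact absurd hσ hπ
        · exact Or.inl h
        · exact Or.inr h
      · have := (pnorm_pos hf).le
        gcongr
        · simp
        · simp
    · have hfin : FiniteMultiplicity π f :=
        FiniteMultiplicity.of_prime_left hπ hf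
      obtain ⟨c, hc, hπc⟩ := hfin.exists_eq_pow_mul_and_not_dvd
      set v := multiplicity π f
      have hc0 : c ≠ 0 := by
        rintro rfl
        exact hπc (dvd_zero _)
      have hpv : π ^ v ≠ 0 := pow_ne_zero _ hπ.ne_zero
      have hdeg : f.natDegree = v * π.natDegree + c.natDegree := by
        conv_lhs => rw [hc]
        rw [natDegree_mul hpv hc0, natDegree_pow]
      have hπ1 : 1 ≤ π.natDegree := hπ.irreducible.natDegree_pos
      have hv : v ≤ f.natDegree := by nlinarith
      have ihc := ih c hc0 fun σ hσ hd => by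
        have := h σ hσ (hc ▸ hd.mul_left _)
        rw [Finset.mem_insert] at this
        rcases this with (rfl | h) | h
        · exact absurd hd hπc
        · exact Or.inl h
        · exact Or.inr h
      calc (tauP F f : ℝ) ≤ tauP F (π ^ v) * tauP F c := by
            conv_lhs => rw [hc]
            exact_mod_cast tauP_mul_le hpv hc0
        _ ≤ (v + 1) * ((c.natDegree + 1) ^ S.card * pnorm F c ^ δ) := by
            gcongr
            exact_mod_cast tauP_prime_pow_le hπ v
        _ ≤ (f.natDegree + 1) * ((f.natDegree + 1) ^ S.card * pnorm F f ^ δ) := by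
            have := (pnorm_pos hc0).le
            gcongr
            · omega
            · conv_rhs => rw [hc]
              rw [pnorm_mul hpv hc0]
              exact le_mul_of_one_le_left this (one_le_pnorm hpv)
        _ = _ := by ring

/-- The divisor bound. -/
theorem exists_tauP_le [Fintype F] {δ : ℝ} (hδ : 0 < δ) :
    ∃ C : ℝ, 0 < C ∧ ∀ f : F[X], f ≠ 0 → (tauP F f : ℝ) ≤ C * pnorm F f ^ δ := by
  have hq := one_lt_card_real (F := F)
  have hq0 : (0 : ℝ) < Fintype.card F := one_pos.trans hq
  set ρ : ℝ := (Fintype.card F : ℝ) ^ (δ / 2) with hρ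
  have hρ1 : 1 < ρ := Real.one_lt_rpow hq (half_pos hδ)
  have hpow : ∀ n : ℕ, ((Fintype.card F : ℝ) ^ n) ^ (δ / 2) = ρ ^ n := fun n => by
    rw [hρ, ← Real.rpow_natCast, ← Real.rpow_mul hq0.le, mul_comm, Real.rpow_mul hq0.le,
      Real.rpow_natCast]
  obtain ⟨D, hD⟩ := pow_unbounded_of_one_lt 2 hρ1
  set S : Finset F[X] := (finite_degree_lt (F := F) D).toFinset with hS
  obtain ⟨M, hM⟩ := (tendsto_pow_const_div_const_pow_of_one_lt S.card hρ1).bddAbove_range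
  have hM' : ∀ n : ℕ, ((n : ℝ) + 1) ^ S.card ≤ M * ρ * ρ ^ n := by
    intro n
    have := hM ⟨n + 1, rfl⟩
    simp only at this
    rw [div_le_iff₀ (pow_pos (one_pos.trans hρ1) _)] at this
    push_cast at this
    rw [pow_succ] at this
    linarith
  have hM0 : 0 < M * ρ := by
    have := hM' 0
    simp at this
    linarith
  refine ⟨M * ρ, hM0, fun f hf => ?_⟩
  have h1 := tauP_le_of_small_primes_mem (F := F) (δ := δ / 2) (D := D)
    (by rw [hpow]; exact hD.le) (half_pos hδ).le S f hf fun π hπ _ => by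
      rw [hS, Set.Finite.mem_toFinset, Set.mem_ofPred_eq, degree_eq_natDegree hπ.ne_zero,
        Nat.cast_lt]
      exact lt_or_ge _ _
  have h2 : pnorm F f ^ δ = ρ ^ f.natDegree * pnorm F f ^ (δ / 2) := by
    rw [← hpow, ← pnorm_eq hf, ← Real.rpow_add (pnorm_pos hf), add_halves]
  rw [h2, ← mul_assoc]
  exact h1.trans (mul_le_mul_of_nonneg_right (hM' _) (Real.rpow_nonneg (pnorm_pos hf).le _))

/-- Möbius inversion: the condition `gcd(a, h) = 1` as a signed sum over divisors of `h`. -/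
theorem exists_moebius [Finite F] {h : F[X]} (hm : h.Monic) (hs : Squarefree h) :
    ∃ T : Finset (Finset F[X]), T.card ≤ tauP F h ∧ (∀ t ∈ T, ∏ π ∈ t, π ∣ h) ∧
      ∀ a : F[X], (if IsCoprime a h then (1 : ℂ) else 0) =
        ∑ t ∈ T, (-1) ^ t.card * if ∏ π ∈ t, π ∣ a then 1 else 0 := by
  set P := (UniqueFactorizationMonoid.normalizedFactors h).toFinset with hP
  have hirr : ∀ π ∈ P, Irreducible π := fun π hπ =>
    UniqueFactorizationMonoid.irreducible_of_normalized_factor π (Multiset.mem_toFinset.1 hπ)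
  have hdvd : ∀ π ∈ P, π ∣ h := fun π hπ =>
    UniqueFactorizationMonoid.dvd_of_mem_normalizedFactors (Multiset.mem_toFinset.1 hπ)
  have hmon : ∀ π ∈ P, π.Monic := fun π hπ => by
    rw [← UniqueFactorizationMonoid.normalize_normalized_factor π (Multiset.mem_toFinset.1 hπ)]
    exact monic_normalize (hirr π hπ).ne_zero
  have heq : ∀ π ∈ P, ∀ σ ∈ P, π ∣ σ → π = σ := fun π hπ σ hσ hd =>
    eq_of_monic_of_associated (hmon π hπ) (hmon σ hσ)
      ((hirr π hπ).associated_of_dvd (hirr σ hσ) hd)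
  have hprod : ∏ π ∈ P, π = h := by
    have hnd := (UniqueFactorizationMonoid.squarefree_iff_nodup_normalizedFactors hm.ne_zero).1 hs
    have h1 := UniqueFactorizationMonoid.prod_normalizedFactors_eq hm.ne_zero
    rw [hm.normalize_eq_self] at h1
    conv_rhs => rw [← h1]
    rw [Finset.prod, hP, Multiset.toFinset_val, hnd.dedup, Multiset.map_id']
  have hpd : ∀ t ⊆ P, ∀ a : F[X], ∏ π ∈ t, π ∣ a ↔ ∀ π ∈ t, π ∣ a := by
    refine fun t ht a => ⟨fun hd π hπ => (Finset.dvd_prod_of_mem _ hπ).trans hd, fun hd =>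
      Finset.prod_dvd_of_coprime ?_ hd⟩
    intro π hπ σ hσ hne
    exact (hirr π (ht hπ)).coprime_iff_not_dvd.2 fun hd => hne (heq π (ht hπ) σ (ht hσ) hd)
  refine ⟨P.powerset, ?_, ?_, fun a => ?_⟩
  · rw [← Set.ncard_coe_finset]
    refine Set.ncard_le_ncard_of_injOn (fun t => ∏ π ∈ t, π) ?_ ?_ (finite_monic_dvd hm.ne_zero)
    · intro t ht
      have ht : t ⊆ P := by simpa using ht
      exact ⟨monic_prod_of_monic _ _ fun π hπ => hmon π (ht hπ),
        (hpd t ht h).2 fun π hπ => hdvd π (ht hπ)⟩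
    · have key : ∀ s ⊆ P, ∀ t ⊆ P, ∏ π ∈ s, π = ∏ π ∈ t, π → s ⊆ t := by
        intro s hs t ht he π hπ
        have h1 : π ∣ ∏ σ ∈ t, σ := he ▸ Finset.dvd_prod_of_mem (fun σ => σ) hπ
        obtain ⟨σ, hσ, hd⟩ := (hirr π (hs hπ)).prime.exists_mem_finset_dvd h1
        rwa [heq π (hs hπ) σ (ht hσ) hd]
      intro s hs t ht he
      have hs : s ⊆ P := by simpa using hs
      have ht : t ⊆ P := by simpa using ht
      exact (key s hs t ht he).antisymm (key t ht s hs he.symm)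
  · intro t ht
    exact (hpd t (Finset.mem_powerset.1 ht) h).2 fun π hπ => hdvd π (Finset.mem_powerset.1 ht hπ)
  · have hc : IsCoprime a h ↔ ∀ π ∈ P, ¬ π ∣ a := by
      refine ⟨fun hc π hπ hd => (hirr π hπ).not_isUnit (hc.isUnit_of_dvd' hd (hdvd π hπ)),
        fun hd => ?_⟩
      rw [← hprod]
      exact IsCoprime.prod_right fun π hπ => ((hirr π hπ).coprime_iff_not_dvd.2 (hd π hπ)).symm
    have h1 : (if IsCoprime a h then (1 : ℂ) else 0) =
        ∏ π ∈ P, (1 + -(if π ∣ a then (1 : ℂ) else 0)) := by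
      split_ifs with hcop
      · refine (Finset.prod_eq_one fun π hπ => ?_).symm
        rw [if_neg (hc.1 hcop π hπ)]
        simp
      · rw [hc] at hcop
        push Not at hcop
        obtain ⟨π, hπ, hd⟩ := hcop
        refine (Finset.prod_eq_zero hπ ?_).symm
        rw [if_pos hd]
        simp
    rw [h1, Finset.prod_one_add]
    refine Finset.sum_congr rfl fun t ht => ?_
    rw [Finset.prod_neg, Finset.prod_ite_zero, Finset.prod_const_one]
    simp only [hpd t (Finset.mem_powerset.1 ht) a]

theorem ite_and_and_eq_mul (A B C : Prop) (z : ℂ) :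
    (if A ∧ B ∧ C then z else 0) =
      (if A then (1 : ℂ) else 0) * ((if B then (1 : ℂ) else 0) * (if C then (1 : ℂ) else 0)) * z := by
  by_cases A <;> by_cases B <;> by_cases C <;> simp [*]

/-- The exponential sum over reduced fractions is bounded by a product of divisor functions. -/
theorem norm_sum_coprime_le [Fintype F] [Algebra (ZMod p) F] {y₁ y₂ y₃ h₁ h₂ h₃ : F[X]}
    (hy12 : y₁ ≠ y₂) (hy13 : y₁ ≠ y₃) (hy23 : y₂ ≠ y₃)
    (hm₁ : h₁.Monic) (hm₂ : h₂.Monic) (hm₃ : h₃.Monic)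
    (hs₁ : Squarefree h₁) (hs₂ : Squarefree h₂) (hs₃ : Squarefree h₃)
    (x : LaurentSeries F) (P : Finset (F[X] × F[X] × F[X]))
    (hP : ∀ a, a ∈ P ↔ IsAdmissible h₁ h₂ h₃ 1 1 1 x a ∧
      IsCoprime a.1 h₁ ∧ IsCoprime a.2.1 h₂ ∧ IsCoprime a.2.2 h₃) :
    ‖∑ a ∈ P, eC p F (phase y₁ y₂ y₃ h₁ h₂ h₃ a)‖ ≤
      ((Fintype.card F ^ ((y₁ - y₂) * (y₁ - y₃) * (y₂ - y₃)).natDegree) ^ 3 : ℕ) *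
        (tauP F h₁ * tauP F h₂ * tauP F h₃) := by
  obtain ⟨T₁, c₁, d₁, m₁⟩ := exists_moebius hm₁ hs₁
  obtain ⟨T₂, c₂, d₂, m₂⟩ := exists_moebius hm₂ hs₂
  obtain ⟨T₃, c₃, d₃, m₃⟩ := exists_moebius hm₃ hs₃
  have hfin := finite_isAdmissible hm₁.ne_zero hm₂.ne_zero hm₃.ne_zero 1 1 1 x
  set Q := hfin.toFinset with hQ
  set M : ℕ := (Fintype.card F ^ ((y₁ - y₂) * (y₁ - y₃) * (y₂ - y₃)).natDegree) ^ 3 with hM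
  set T := T₁ ×ˢ T₂ ×ˢ T₃ with hT
  set e := fun a => eC p F (phase y₁ y₂ y₃ h₁ h₂ h₃ a) with he
  let I : Finset F[X] × Finset F[X] × Finset F[X] → F[X] × F[X] × F[X] → Prop := fun t a =>
    ∏ π ∈ t.1, π ∣ a.1 ∧ ∏ π ∈ t.2.1, π ∣ a.2.1 ∧ ∏ π ∈ t.2.2, π ∣ a.2.2
  have hsum : ∑ a ∈ P, e a = ∑ t ∈ T, ((-1) ^ t.1.card * (-1) ^ t.2.1.card * (-1) ^ t.2.2.card) *
      ∑ a ∈ Q with I t a, e a := by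
    have hPQ : P = Q.filter fun a => IsCoprime a.1 h₁ ∧ IsCoprime a.2.1 h₂ ∧ IsCoprime a.2.2 h₃ := by
      ext a
      rw [hP, Finset.mem_filter, hQ, Set.Finite.mem_toFinset]
      rfl
    rw [hPQ, Finset.sum_filter]
    simp only [Finset.sum_filter, Finset.mul_sum]
    rw [Finset.sum_comm]
    refine Finset.sum_congr rfl fun a _ => ?_
    rw [ite_and_and_eq_mul, m₁, m₂, m₃, Finset.sum_mul_sum, ← Finset.sum_product',
      Finset.sum_mul_sum, ← Finset.sum_product', Finset.sum_mul]
    refine Finset.sum_congr rfl fun t _ => ?_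
    rw [ite_and_and_eq_mul]
    ring
  rw [hsum]
  calc ‖∑ t ∈ T, ((-1) ^ t.1.card * (-1) ^ t.2.1.card * (-1) ^ t.2.2.card) *
      ∑ a ∈ Q with I t a, e a‖ ≤ ∑ t ∈ T, (M : ℝ) := by
        refine norm_sum_le_of_le _ fun t ht => ?_
        rw [hT, Finset.mem_product, Finset.mem_product] at ht
        rw [norm_mul]
        have h1 : ‖((-1) ^ t.1.card * (-1) ^ t.2.1.card * (-1) ^ t.2.2.card : ℂ)‖ = 1 := by
          simp
        rw [h1, one_mul]
        refine norm_sum_isAdmissible_le p hy12 hy13 hy23 hm₁.ne_zero hm₂.ne_zero hm₃.ne_zero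
          (d₁ _ ht.1) (d₂ _ ht.2.1) (d₃ _ ht.2.2) x _ fun a => ?_
        rw [Finset.mem_filter, hQ, Set.Finite.mem_toFinset]
        exact ⟨fun h => ⟨h.1.1, h.1.2, h.1.3, h.2.1, h.2.2.1, h.2.2.2, h.1.7⟩,
          fun h => ⟨⟨h.1, h.2, h.3, one_dvd _, one_dvd _, one_dvd _, h.7⟩, h.4, h.5, h.6⟩⟩
    _ = M * (T₁.card * T₂.card * T₃.card) := by
        rw [Finset.sum_const, hT, Finset.card_product, Finset.card_product, nsmul_eq_mul]
        push_cast
        ring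
    _ ≤ _ := by gcongr

end Divisors

/-! ### Summation over triples of moduli -/

section Summation

variable {F : Type} [Field F] [Fintype F]

theorem exists_sum_pnorm_rpow_le {s : ℝ} (hs : 1 < s) :
    ∃ Z : ℝ, 0 < Z ∧ ∀ G : Finset F[X], (∀ f ∈ G, f ≠ 0) → ∑ f ∈ G, pnorm F f ^ (-s) ≤ Z := by
  have hq := one_lt_card_real (F := F)
  set q : ℝ := (Fintype.card F : ℝ) with hqdef
  have hq0 : 0 < q := one_pos.trans hq
  set ρ : ℝ := q ^ (1 - s) with hρ
  have hρ0 : 0 < ρ := Real.rpow_pos_of_pos hq0 _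
  have hρ1 : ρ < 1 := Real.rpow_lt_one_of_one_lt_of_neg hq (by linarith)
  refine ⟨q * (1 - ρ)⁻¹, mul_pos hq0 (inv_pos.2 (by linarith)), fun G hG => ?_⟩
  have hterm : ∀ n : ℕ, ∑ f ∈ G with f.natDegree = n, pnorm F f ^ (-s) ≤ q * ρ ^ n := by
    intro n
    have hcard : ((G.filter fun f => f.natDegree = n).card : ℝ) ≤ q ^ (n + 1) := by
      rw [← Set.ncard_coe_finset]
      have := Set.ncard_le_ncard (s := ((G.filter fun f => f.natDegree = n : Finset F[X]) : Set F[X]))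
        (t := {f : F[X] | f.degree < (n + 1 : ℕ)}) ?_ (finite_degree_lt _)
      · rw [ncard_degree_lt] at this
        rw [hqdef]; exact_mod_cast this
      · intro f hf
        have hf := Finset.mem_filter.1 (Finset.mem_coe.1 hf)
        rw [Set.mem_ofPred_eq, degree_eq_natDegree (hG f hf.1), hf.2]
        exact_mod_cast Nat.lt_succ_self n
    calc ∑ f ∈ G with f.natDegree = n, pnorm F f ^ (-s)
        = ∑ f ∈ G with f.natDegree = n, (q ^ n) ^ (-s) := by
          refine Finset.sum_congr rfl fun f hf => ?_
          rw [Finset.mem_filter] at hf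
          rw [pnorm_eq (hG f hf.1), hf.2]
      _ = ((G.filter fun f => f.natDegree = n).card : ℝ) * (q ^ n) ^ (-s) := by
          rw [Finset.sum_const, nsmul_eq_mul]
      _ ≤ q ^ (n + 1) * (q ^ n) ^ (-s) := by gcongr
      _ = q * ρ ^ n := by
          rw [hρ, ← Real.rpow_natCast (q ^ (1 - s)), ← Real.rpow_mul hq0.le,
            ← Real.rpow_natCast q n, ← Real.rpow_mul hq0.le, ← Real.rpow_natCast q (n + 1),
            ← Real.rpow_add hq0]
          conv_rhs => rw [← Real.rpow_one q, ← Real.rpow_mul hq0.le, ← Real.rpow_add hq0]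
          congr 1
          push_cast
          ring
  set N := G.sup natDegree + 1 with hN
  rw [← Finset.sum_fiberwise_of_maps_to (t := Finset.range N) (g := natDegree)
    (fun f hf => Finset.mem_range.2 (Nat.lt_succ_of_le (Finset.le_sup hf)))]
  calc ∑ n ∈ Finset.range N, ∑ f ∈ G with f.natDegree = n, pnorm F f ^ (-s)
      ≤ ∑ n ∈ Finset.range N, q * ρ ^ n := Finset.sum_le_sum fun n _ => hterm n
    _ = q * ∑ n ∈ Finset.range N, ρ ^ n := by rw [Finset.mul_sum]
    _ ≤ q * (1 - ρ)⁻¹ := by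
        gcongr
        rw [← tsum_geometric_of_lt_one hρ0.le hρ1]
        exact (summable_geometric_of_lt_one hρ0.le hρ1).sum_le_tsum _ fun n _ => by positivity

theorem rpow_weight_le {a g u v r Y ε δ : ℝ} (ha : 0 < a) (hg : 0 < g) (hu : 0 < u) (hv : 0 < v)
    (hr : 0 < r) (hY : 0 < Y) (hYa : Y ≤ a) (h : u * v ≤ a * r) (hε : ε ≤ 1) (hδ : δ ≤ ε) :
    (a * (g * u) * (g * v)) ^ (-1 + δ) ≤
      Y ^ (ε - 1) * r ^ (ε - δ) *
        (g ^ (-2 + 2 * δ) * u ^ (-1 - ε + 2 * δ) * v ^ (-1 - ε + 2 * δ)) := by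
  have h1 : a ^ (ε - 1) ≤ Y ^ (ε - 1) := Real.rpow_le_rpow_of_nonpos hY hYa (by linarith)
  have h2 : a ^ (δ - ε) ≤ r ^ (ε - δ) * (u ^ (δ - ε) * v ^ (δ - ε)) := by
    have h3 := Real.rpow_le_rpow_of_nonpos (mul_pos hu hv) h (show δ - ε ≤ 0 by linarith)
    rw [Real.mul_rpow ha.le hr.le, Real.mul_rpow hu.le hv.le] at h3
    have h4 : r ^ (ε - δ) * r ^ (δ - ε) = 1 := by
      rw [← Real.rpow_add hr]
      simp
    calc a ^ (δ - ε) = r ^ (ε - δ) * (a ^ (δ - ε) * r ^ (δ - ε)) := by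
          rw [mul_left_comm, h4, mul_one]
      _ ≤ _ := by gcongr
  have h5 : a ^ (-1 + δ) = a ^ (ε - 1) * a ^ (δ - ε) := by
    rw [← Real.rpow_add ha]
    ring_nf
  have h6 : g ^ (-2 + 2 * δ) = g ^ (-1 + δ) * g ^ (-1 + δ) := by
    rw [← Real.rpow_add hg]
    ring_nf
  have h7 : ∀ {z : ℝ}, 0 < z → z ^ (-1 - ε + 2 * δ) = z ^ (δ - ε) * z ^ (-1 + δ) := fun hz => by
    rw [← Real.rpow_add hz]
    ring_nf
  rw [Real.mul_rpow (by positivity) (by positivity), Real.mul_rpow (by positivity) (by positivity),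
    Real.mul_rpow hg.le hu.le, Real.mul_rpow hg.le hv.le, h5, h6, h7 hu, h7 hv]
  calc a ^ (ε - 1) * a ^ (δ - ε) * (g ^ (-1 + δ) * u ^ (-1 + δ)) * (g ^ (-1 + δ) * v ^ (-1 + δ))
      ≤ Y ^ (ε - 1) * (r ^ (ε - δ) * (u ^ (δ - ε) * v ^ (δ - ε))) *
        (g ^ (-1 + δ) * u ^ (-1 + δ)) * (g ^ (-1 + δ) * v ^ (-1 + δ)) := by gcongr
    _ = _ := by ring

/-- The tail of the sum over triples of moduli, each dividing the product of the other two
and `r`. -/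
theorem exists_sum_triples_le {ε : ℝ} (hε : 0 < ε) (hε' : ε ≤ 1 / 2) :
    ∃ C : ℝ, 0 < C ∧ ∀ (ι : Type) (T : Finset ι) (h₁ h₂ h₃ : ι → F[X]) (r : F[X]) (X : ℝ),
      (∀ i ∈ T, ∀ j ∈ T, h₁ i = h₁ j → h₂ i = h₂ j → h₃ i = h₃ j → i = j) → r ≠ 0 →
      (∀ i ∈ T, (h₁ i).Monic ∧ (h₂ i).Monic ∧ (h₃ i).Monic ∧ h₁ i ∣ h₂ i * h₃ i * r ∧
        h₂ i ∣ h₁ i * h₃ i * r ∧ h₃ i ∣ h₁ i * h₂ i * r ∧ X ≤ (h₁ i).natDegree) →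
      ∑ i ∈ T, (pnorm F (h₁ i) * pnorm F (h₂ i) * pnorm F (h₃ i)) ^ (-1 + ε / 4) ≤
        C * pnorm F r ^ ε * (Fintype.card F : ℝ) ^ (X * (ε - 1)) := by
  have hq := one_lt_card_real (F := F)
  have hq0 : (0 : ℝ) < Fintype.card F := one_pos.trans hq
  set δ := ε / 4 with hδ
  have hδ0 : 0 < δ := by positivity
  obtain ⟨K, hK0, hK⟩ := exists_tauP_le (F := F) hδ0
  obtain ⟨Z, hZ0, hZ⟩ := exists_sum_pnorm_rpow_le (F := F) (s := 2 - ε) (by linarith)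
  obtain ⟨W, hW0, hW⟩ := exists_sum_pnorm_rpow_le (F := F) (s := 1 + δ) (by linarith)
  refine ⟨K * (Z * W * W), by positivity, fun ι T h₁ h₂ h₃ r X hinj hr hT => ?_⟩
  choose! g u v hgu hgv huv using
    fun i (hi : i ∈ T) => exists_eq_mul_isCoprime (h₂ i) (hT i hi).2.2.1.ne_zero
  have hne : ∀ i ∈ T, g i ≠ 0 ∧ u i ≠ 0 ∧ v i ≠ 0 := fun i hi =>
    ⟨left_ne_zero_of_mul (hgu i hi ▸ (hT i hi).2.1.ne_zero),
      right_ne_zero_of_mul (hgu i hi ▸ (hT i hi).2.1.ne_zero),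
      right_ne_zero_of_mul (hgv i hi ▸ (hT i hi).2.2.1.ne_zero)⟩
  set κ : ι → F[X] × F[X] × F[X] := fun i => (g i, u i, v i) with hκ
  set w : F[X] × F[X] × F[X] → ℝ := fun k => pnorm F k.1 ^ (-2 + 2 * δ) *
    pnorm F k.2.1 ^ (-1 - ε + 2 * δ) * pnorm F k.2.2 ^ (-1 - ε + 2 * δ) with hw
  set A : ℝ := (Fintype.card F : ℝ) ^ (X * (ε - 1)) * pnorm F r ^ (ε - δ) with hA
  have hA0 : 0 ≤ A := mul_nonneg (Real.rpow_nonneg hq0.le _) (Real.rpow_nonneg (pnorm_pos hr).le _)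
  have hpt : ∀ i ∈ T, (pnorm F (h₁ i) * pnorm F (h₂ i) * pnorm F (h₃ i)) ^ (-1 + δ) ≤
      A * w (κ i) := by
    intro i hi
    obtain ⟨m₁, m₂, m₃, d₁, d₂, d₃, hX⟩ := hT i hi
    obtain ⟨g0, u0, v0⟩ := hne i hi
    have hu : u i ∣ h₁ i * r := by
      rw [hgu i hi, hgv i hi, show h₁ i * (g i * v i) * r = g i * (h₁ i * r * v i) by ring,
        mul_dvd_mul_iff_left g0] at d₂
      exact (huv i hi).dvd_of_dvd_mul_right d₂
    have hv : v i ∣ h₁ i * r := by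
      rw [hgu i hi, hgv i hi, show h₁ i * (g i * u i) * r = g i * (h₁ i * r * u i) by ring,
        mul_dvd_mul_iff_left g0] at d₃
      exact (huv i hi).symm.dvd_of_dvd_mul_right d₃
    have hle : pnorm F (u i) * pnorm F (v i) ≤ pnorm F (h₁ i) * pnorm F r := by
      rw [← pnorm_mul u0 v0, ← pnorm_mul m₁.ne_zero hr, pnorm_eq (mul_ne_zero u0 v0),
        pnorm_eq (mul_ne_zero m₁.ne_zero hr)]
      exact pow_le_pow_right₀ hq.le
        (natDegree_le_of_dvd ((huv i hi).mul_dvd hu hv) (mul_ne_zero m₁.ne_zero hr))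
    have hY : (Fintype.card F : ℝ) ^ X ≤ pnorm F (h₁ i) := by
      rw [pnorm_eq m₁.ne_zero, ← Real.rpow_natCast]
      exact Real.rpow_le_rpow_of_exponent_le hq.le hX
    have := rpow_weight_le (pnorm_pos m₁.ne_zero) (pnorm_pos g0) (pnorm_pos u0) (pnorm_pos v0)
      (pnorm_pos hr) (Real.rpow_pos_of_pos hq0 X) hY hle (ε := ε) (δ := δ) (by linarith)
      (by linarith)
    rw [← Real.rpow_mul hq0.le] at this
    rw [hgu i hi, hgv i hi, pnorm_mul g0 u0, pnorm_mul g0 v0]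
    exact this
  have hfib : ∀ k ∈ T.image κ, (((T.filter fun i => κ i = k).card : ℝ)) * w k ≤
      K * pnorm F r ^ δ * (pnorm F k.1 ^ (-(2 - ε)) * (pnorm F k.2.1 ^ (-(1 + δ)) *
        pnorm F k.2.2 ^ (-(1 + δ)))) := by
    intro k hk
    obtain ⟨j, hj, rfl⟩ := Finset.mem_image.1 hk
    obtain ⟨g0, u0, v0⟩ := hne j hj
    have hgu0 := mul_ne_zero g0 u0
    have hgv0 := mul_ne_zero g0 v0
    have hprod : g j * u j * (g j * v j) * r ≠ 0 := mul_ne_zero (mul_ne_zero hgu0 hgv0) hr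
    have hcard : (T.filter fun i => κ i = κ j).card ≤ tauP F (g j * u j * (g j * v j) * r) := by
      rw [← Set.ncard_coe_finset]
      refine Set.ncard_le_ncard_of_injOn h₁ ?_ ?_ (finite_monic_dvd hprod)
      · intro i hi
        obtain ⟨hi, hij⟩ := Finset.mem_filter.1 (Finset.mem_coe.1 hi)
        simp only [hκ, Prod.mk.injEq] at hij
        obtain ⟨m₁, -, -, d₁, -⟩ := hT i hi
        rw [hgu i hi, hgv i hi, hij.1, hij.2.1, hij.2.2] at d₁
        exact ⟨m₁, d₁⟩
      · intro i hi i' hi' h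
        obtain ⟨hi, hij⟩ := Finset.mem_filter.1 (Finset.mem_coe.1 hi)
        obtain ⟨hi', hij'⟩ := Finset.mem_filter.1 (Finset.mem_coe.1 hi')
        simp only [hκ, Prod.mk.injEq] at hij hij'
        refine hinj i hi i' hi' h ?_ ?_
        · rw [hgu i hi, hgu i' hi', hij.1, hij.2.1, hij'.1, hij'.2.1]
        · rw [hgv i hi, hgv i' hi', hij.1, hij.2.2, hij'.1, hij'.2.2]
    have hτ : ((T.filter fun i => κ i = κ j).card : ℝ) ≤
        K * (pnorm F (g j) ^ δ * pnorm F (u j) ^ δ * (pnorm F (g j) ^ δ * pnorm F (v j) ^ δ) *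
          pnorm F r ^ δ) := by
      refine (Nat.cast_le.2 hcard).trans ((hK _ hprod).trans_eq ?_)
      rw [pnorm_mul_rpow (mul_ne_zero hgu0 hgv0) hr, pnorm_mul_rpow hgu0 hgv0,
        pnorm_mul_rpow g0 u0, pnorm_mul_rpow g0 v0]
    have pg := pnorm_pos g0
    have pu := pnorm_pos u0
    have pv := pnorm_pos v0
    have e₁ : pnorm F (g j) ^ (-(2 - ε)) =
        pnorm F (g j) ^ δ * pnorm F (g j) ^ δ * pnorm F (g j) ^ (-2 + 2 * δ) := by
      rw [← Real.rpow_add pg, ← Real.rpow_add pg, hδ]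
      ring_nf
    have e₂ : ∀ {z : ℝ}, 0 < z → z ^ (-(1 + δ)) = z ^ δ * z ^ (-1 - ε + 2 * δ) := fun hz => by
      rw [← Real.rpow_add hz, hδ]
      ring_nf
    have hw0 : 0 ≤ w (κ j) := by
      simp only [hw, hκ]
      positivity
    refine (mul_le_mul_of_nonneg_right hτ hw0).trans_eq ?_
    simp only [hw, hκ]
    rw [e₁, e₂ pu, e₂ pv]
    ring
  have him : ∀ k ∈ T.image κ, k.1 ≠ 0 ∧ k.2.1 ≠ 0 ∧ k.2.2 ≠ 0 := by
    intro k hk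
    obtain ⟨j, hj, rfl⟩ := Finset.mem_image.1 hk
    exact hne j hj
  set G := (T.image κ).image Prod.fst with hG
  set U := (T.image κ).image (fun k => k.2.1) with hU
  set V := (T.image κ).image (fun k => k.2.2) with hV
  have hG0 : ∀ f ∈ G, f ≠ 0 := by
    intro f hf
    obtain ⟨k, hk, rfl⟩ := Finset.mem_image.1 hf
    exact (him k hk).1
  have hU0 : ∀ f ∈ U, f ≠ 0 := by
    intro f hf
    obtain ⟨k, hk, rfl⟩ := Finset.mem_image.1 hf
    exact (him k hk).2.1
  have hV0 : ∀ f ∈ V, f ≠ 0 := by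
    intro f hf
    obtain ⟨k, hk, rfl⟩ := Finset.mem_image.1 hf
    exact (him k hk).2.2
  have hbox : ∑ k ∈ T.image κ, pnorm F k.1 ^ (-(2 - ε)) * (pnorm F k.2.1 ^ (-(1 + δ)) *
      pnorm F k.2.2 ^ (-(1 + δ))) ≤ Z * (W * W) := by
    calc _ ≤ ∑ k ∈ G ×ˢ U ×ˢ V, pnorm F k.1 ^ (-(2 - ε)) * (pnorm F k.2.1 ^ (-(1 + δ)) *
            pnorm F k.2.2 ^ (-(1 + δ))) := by
          refine Finset.sum_le_sum_of_subset_of_nonneg (fun k hk => ?_) fun k hk _ => ?_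
          · simp only [Finset.mem_product]
            exact ⟨Finset.mem_image_of_mem _ hk, Finset.mem_image_of_mem (fun k => k.2.1) hk,
              Finset.mem_image_of_mem (fun k => k.2.2) hk⟩
          · simp only [Finset.mem_product] at hk
            have p₁ := pnorm_pos (hG0 _ hk.1)
            have p₂ := pnorm_pos (hU0 _ hk.2.1)
            have p₃ := pnorm_pos (hV0 _ hk.2.2)
            positivity
      _ = (∑ f ∈ G, pnorm F f ^ (-(2 - ε))) * ((∑ f ∈ U, pnorm F f ^ (-(1 + δ))) *
            ∑ f ∈ V, pnorm F f ^ (-(1 + δ))) := by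
          rw [Finset.sum_mul_sum, ← Finset.sum_product', Finset.sum_mul_sum, ← Finset.sum_product']
      _ ≤ Z * (W * W) := by
          have nn : ∀ {G : Finset F[X]} {s : ℝ}, (∀ f ∈ G, f ≠ 0) →
              0 ≤ ∑ f ∈ G, pnorm F f ^ s := fun h =>
            Finset.sum_nonneg fun f hf => Real.rpow_nonneg (pnorm_pos (h f hf)).le _
          have n₁ := nn (s := -(1 + δ)) hU0
          have n₂ := nn (s := -(1 + δ)) hV0
          exact mul_le_mul (hZ G hG0) (mul_le_mul (hW U hU0) (hW V hV0) n₂ hW0.le)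
            (mul_nonneg n₁ n₂) hZ0.le
  have hr0 := pnorm_pos hr
  calc ∑ i ∈ T, (pnorm F (h₁ i) * pnorm F (h₂ i) * pnorm F (h₃ i)) ^ (-1 + δ)
      ≤ ∑ i ∈ T, A * w (κ i) := Finset.sum_le_sum hpt
    _ = A * ∑ k ∈ T.image κ, ((T.filter fun i => κ i = k).card : ℝ) * w k := by
        rw [← Finset.mul_sum, Finset.sum_comp]
        simp only [nsmul_eq_mul]
    _ ≤ A * ∑ k ∈ T.image κ, K * pnorm F r ^ δ * (pnorm F k.1 ^ (-(2 - ε)) *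
          (pnorm F k.2.1 ^ (-(1 + δ)) * pnorm F k.2.2 ^ (-(1 + δ)))) :=
        mul_le_mul_of_nonneg_left (Finset.sum_le_sum hfib) hA0
    _ ≤ A * (K * pnorm F r ^ δ * (Z * (W * W))) := by
        rw [← Finset.mul_sum]
        gcongr
    _ = K * (Z * W * W) * (pnorm F r ^ (ε - δ) * pnorm F r ^ δ) *
          (Fintype.card F : ℝ) ^ (X * (ε - 1)) := by
        rw [hA]
        ring
    _ = _ := by
        rw [← Real.rpow_add hr0, sub_add_cancel]

end Summation

section Assembly

variable {F : Type} [Field F]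

/-- The inner sum in `tripleBeta`. -/
def reducedSum [Algebra (ZMod p) F] (y₁ y₂ y₃ b r h₁ h₂ h₃ : F[X]) : ℂ :=
  ∑ᶠ a ∈ {a : F[X] × F[X] × F[X] |
      a.1.degree < h₁.degree ∧ a.2.1.degree < h₂.degree ∧ a.2.2.degree < h₃.degree ∧
      IsCoprime a.1 h₁ ∧ IsCoprime a.2.1 h₂ ∧ IsCoprime a.2.2 h₃ ∧
      ∃ g : F[X], toK F a.1 / toK F h₁ + toK F a.2.1 / toK F h₂ + toK F a.2.2 / toK F h₃ -
        toK F b / toK F r = toK F g},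
    eC p F (phase y₁ y₂ y₃ h₁ h₂ h₃ a)

theorem norm_reducedSum_le [Fintype F] [Algebra (ZMod p) F] {y₁ y₂ y₃ h₁ h₂ h₃ : F[X]}
    (hy12 : y₁ ≠ y₂) (hy13 : y₁ ≠ y₃) (hy23 : y₂ ≠ y₃)
    (hm₁ : h₁.Monic) (hm₂ : h₂.Monic) (hm₃ : h₃.Monic)
    (hs₁ : Squarefree h₁) (hs₂ : Squarefree h₂) (hs₃ : Squarefree h₃) (b r : F[X]) :
    ‖reducedSum p y₁ y₂ y₃ b r h₁ h₂ h₃‖ ≤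
      ((Fintype.card F ^ ((y₁ - y₂) * (y₁ - y₃) * (y₂ - y₃)).natDegree) ^ 3 : ℕ) *
        (tauP F h₁ * tauP F h₂ * tauP F h₃) := by
  have hfin : {a : F[X] × F[X] × F[X] |
      a.1.degree < h₁.degree ∧ a.2.1.degree < h₂.degree ∧ a.2.2.degree < h₃.degree ∧
      IsCoprime a.1 h₁ ∧ IsCoprime a.2.1 h₂ ∧ IsCoprime a.2.2 h₃ ∧
      ∃ g : F[X], toK F a.1 / toK F h₁ + toK F a.2.1 / toK F h₂ + toK F a.2.2 / toK F h₃ -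
        toK F b / toK F r = toK F g}.Finite := by
    apply (finite_isAdmissible hm₁.ne_zero hm₂.ne_zero hm₃.ne_zero 1 1 1
      (toK F b / toK F r)).subset
    rintro a ⟨d₁, d₂, d₃, -, -, -, hg⟩
    exact ⟨d₁, d₂, d₃, one_dvd _, one_dvd _, one_dvd _, hg⟩
  rw [reducedSum, finsum_mem_eq_finite_toFinset_sum _ hfin]
  refine norm_sum_coprime_le p hy12 hy13 hy23 hm₁ hm₂ hm₃ hs₁ hs₂ hs₃ (toK F b / toK F r) _
    fun a => ?_
  rw [Set.Finite.mem_toFinset]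
  constructor
  · rintro ⟨d₁, d₂, d₃, c₁, c₂, c₃, hg⟩
    exact ⟨⟨d₁, d₂, d₃, one_dvd _, one_dvd _, one_dvd _, hg⟩, c₁, c₂, c₃⟩
  · rintro ⟨⟨d₁, d₂, d₃, -, -, -, hg⟩, c₁, c₂, c₃⟩
    exact ⟨d₁, d₂, d₃, c₁, c₂, c₃, hg⟩

theorem dvd_of_toK_sub {a₁ a₂ a₃ b h₁ h₂ h₃ r g : F[X]} (e₁ : h₁ ≠ 0) (e₂ : h₂ ≠ 0) (e₃ : h₃ ≠ 0)
    (e₄ : r ≠ 0) (hc : IsCoprime a₁ h₁)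
    (h : toK F a₁ / toK F h₁ + toK F a₂ / toK F h₂ + toK F a₃ / toK F h₃ - toK F b / toK F r =
      toK F g) : h₁ ∣ h₂ * h₃ * r := by
  have f₁ := toK_ne_zero e₁
  have f₂ := toK_ne_zero e₂
  have f₃ := toK_ne_zero e₃
  have f₄ := toK_ne_zero e₄
  have : a₁ * (h₂ * h₃ * r) =
      h₁ * (g * h₂ * h₃ * r - a₂ * h₃ * r - a₃ * h₂ * r + b * h₂ * h₃) := by
    apply toK_injective
    simp only [toK_mul, toK_sub, toK_add, ← h]
    field_simp
    ring
  exact hc.symm.dvd_of_dvd_mul_left ⟨_, this⟩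

theorem dvd_of_reducedSum_ne_zero [Algebra (ZMod p) F] {y₁ y₂ y₃ h₁ h₂ h₃ b r : F[X]}
    (e₁ : h₁ ≠ 0) (e₂ : h₂ ≠ 0) (e₃ : h₃ ≠ 0) (e₄ : r ≠ 0)
    (h : reducedSum p y₁ y₂ y₃ b r h₁ h₂ h₃ ≠ 0) :
    h₁ ∣ h₂ * h₃ * r ∧ h₂ ∣ h₁ * h₃ * r ∧ h₃ ∣ h₁ * h₂ * r := by
  obtain ⟨a, ⟨-, -, -, c₁, c₂, c₃, g, hg⟩, -⟩ := exists_ne_zero_of_finsum_mem_ne_zero h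
  refine ⟨dvd_of_toK_sub e₁ e₂ e₃ e₄ c₁ hg,
    dvd_of_toK_sub (a₂ := a.1) (a₃ := a.2.2) (b := b) (g := g) e₂ e₁ e₃ e₄ c₂ ?_,
    dvd_of_toK_sub (a₂ := a.1) (a₃ := a.2.1) (b := b) (g := g) e₃ e₁ e₂ e₄ c₃ ?_⟩
  · rw [← hg]
    ring
  · rw [← hg]
    ring

theorem finsum_mem_monic_eq_sum {f : F[X] → ℂ} {S : Finset F[X]} (hS : ∀ h ∈ S, h.Monic)
    (hf : ∀ h, f h ≠ 0 → h ∈ S) (H : F[X] → Prop) :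
    ∑ᶠ h ∈ {h : F[X] | h.Monic ∧ H h}, f h = ∑ h ∈ S, if H h then f h else 0 := by
  rw [← Finset.sum_filter]
  apply finsum_mem_eq_sum_of_subset
  · rintro h ⟨⟨-, hH⟩, h0⟩
    exact Finset.mem_coe.2 (Finset.mem_filter.2 ⟨hf h h0, hH⟩)
  · intro h hh
    obtain ⟨h1, h2⟩ := Finset.mem_filter.1 (Finset.mem_coe.1 hh)
    exact ⟨hS h h1, h2⟩

theorem tripleBeta_eq_sum [Algebra (ZMod p) F] {α₁ α₂ α₃ : F[X] → ℂ} {S₁ S₂ S₃ : Finset F[X]}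
    (m₁ : ∀ h ∈ S₁, h.Monic) (m₂ : ∀ h ∈ S₂, h.Monic) (m₃ : ∀ h ∈ S₃, h.Monic)
    (s₁ : ∀ h, α₁ h ≠ 0 → h ∈ S₁) (s₂ : ∀ h, α₂ h ≠ 0 → h ∈ S₂) (s₃ : ∀ h, α₃ h ≠ 0 → h ∈ S₃)
    (y₁ y₂ y₃ b r : F[X]) (H₁ H₂ H₃ : F[X] → Prop) :
    tripleBeta p F α₁ α₂ α₃ y₁ y₂ y₃ b r H₁ H₂ H₃ =
      ∑ i ∈ S₁ ×ˢ S₂ ×ˢ S₃, if H₁ i.1 ∧ H₂ i.2.1 ∧ H₃ i.2.2 then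
        α₁ i.1 * α₂ i.2.1 * α₃ i.2.2 * reducedSum p y₁ y₂ y₃ b r i.1 i.2.1 i.2.2 else 0 := by
  have inner : ∀ h₁ h₂, ∑ᶠ h₃ ∈ {h : F[X] | h.Monic ∧ H₃ h},
      α₁ h₁ * α₂ h₂ * α₃ h₃ * reducedSum p y₁ y₂ y₃ b r h₁ h₂ h₃ = ∑ h₃ ∈ S₃, if H₃ h₃ then
        α₁ h₁ * α₂ h₂ * α₃ h₃ * reducedSum p y₁ y₂ y₃ b r h₁ h₂ h₃ else 0 := fun h₁ h₂ =>
    finsum_mem_monic_eq_sum m₃ (fun h hh => s₃ h fun h0 => hh (by simp [h0])) H₃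
  have middle : ∀ h₁, ∑ᶠ h₂ ∈ {h : F[X] | h.Monic ∧ H₂ h}, (∑ h₃ ∈ S₃, if H₃ h₃ then
        α₁ h₁ * α₂ h₂ * α₃ h₃ * reducedSum p y₁ y₂ y₃ b r h₁ h₂ h₃ else 0) =
      ∑ h₂ ∈ S₂, if H₂ h₂ then (∑ h₃ ∈ S₃, if H₃ h₃ then
        α₁ h₁ * α₂ h₂ * α₃ h₃ * reducedSum p y₁ y₂ y₃ b r h₁ h₂ h₃ else 0) else 0 := fun h₁ =>
    finsum_mem_monic_eq_sum m₂ (fun h hh => s₂ h fun h0 => hh (by simp [h0])) H₂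
  change ∑ᶠ h₁ ∈ {h : F[X] | h.Monic ∧ H₁ h}, ∑ᶠ h₂ ∈ {h : F[X] | h.Monic ∧ H₂ h},
    ∑ᶠ h₃ ∈ {h : F[X] | h.Monic ∧ H₃ h},
      α₁ h₁ * α₂ h₂ * α₃ h₃ * reducedSum p y₁ y₂ y₃ b r h₁ h₂ h₃ = _
  simp only [inner, middle]
  rw [finsum_mem_monic_eq_sum m₁ (fun h hh => s₁ h fun h0 => hh (by simp [h0])) H₁]
  simp only [Finset.sum_product]
  refine Finset.sum_congr rfl fun h₁ _ => ?_
  by_cases c₁ : H₁ h₁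
  · simp only [c₁, if_true, true_and]
    refine Finset.sum_congr rfl fun h₂ _ => ?_
    by_cases c₂ : H₂ h₂ <;> simp [c₂]
  · simp [c₁]

/-- The divisor bound, in the form needed for the coefficients. -/
theorem exists_tauP_rpow_le [Fintype F] {B δ : ℝ} (hB : 0 < B) (hδ : 0 < δ) :
    ∃ K : ℝ, 0 < K ∧ ∀ f : F[X], f ≠ 0 → (tauP F f : ℝ) ^ B * tauP F f ≤ K * pnorm F f ^ δ := by
  have hB1 : 0 < B + 1 := by positivity
  obtain ⟨K, hK0, hK⟩ := exists_tauP_le (F := F) (δ := δ / (B + 1)) (by positivity)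
  refine ⟨K ^ (B + 1), by positivity, fun f hf => ?_⟩
  have hN := pnorm_pos hf
  have ht : (0 : ℝ) < tauP F f := by exact_mod_cast one_le_tauP hf
  calc (tauP F f : ℝ) ^ B * tauP F f = (tauP F f : ℝ) ^ (B + 1) := by
        rw [Real.rpow_add ht, Real.rpow_one]
    _ ≤ (K * pnorm F f ^ (δ / (B + 1))) ^ (B + 1) :=
        Real.rpow_le_rpow ht.le (hK f hf) hB1.le
    _ = K ^ (B + 1) * pnorm F f ^ δ := by
        rw [Real.mul_rpow hK0.le (by positivity), ← Real.rpow_mul hN.le,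
          div_mul_cancel₀ _ hB1.ne']

theorem norm_coeff_mul_tauP_le [Fintype F] {B δ K : ℝ} {α : F[X] → ℂ} {h : F[X]} (hm : h.Monic)
    (hK : ∀ f : F[X], f ≠ 0 → (tauP F f : ℝ) ^ B * tauP F f ≤ K * pnorm F f ^ δ)
    (hα : ‖α h‖ ≤ (tauP F h : ℝ) ^ B / pnorm F h) :
    ‖α h‖ * tauP F h ≤ K * pnorm F h ^ (-1 + δ) := by
  have hN := pnorm_pos hm.ne_zero
  calc ‖α h‖ * tauP F h ≤ (tauP F h : ℝ) ^ B / pnorm F h * tauP F h := by gcongr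
    _ = (tauP F h : ℝ) ^ B * tauP F h / pnorm F h := by ring
    _ ≤ K * pnorm F h ^ δ / pnorm F h := div_le_div_of_nonneg_right (hK h hm.ne_zero) hN.le
    _ = K * pnorm F h ^ (-1 + δ) := by
      rw [Real.rpow_add hN, Real.rpow_neg_one]; ring

end Assembly

/-- The truncation bound for exponents at most `1 / 2`. -/
theorem exists_norm_tripleBeta_sub_le {F : Type} [Field F] [Fintype F] [Algebra (ZMod p) F]
    {B ε : ℝ} (hB : 0 < B) (hε : 0 < ε) (hε' : ε ≤ 1 / 2) {y₁ y₂ y₃ : F[X]}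
    (hy12 : y₁ ≠ y₂) (hy13 : y₁ ≠ y₃) (hy23 : y₂ ≠ y₃) :
    ∃ C : ℝ, 0 < C ∧ ∀ α₁ α₂ α₃ : F[X] → ℂ,
      ((Function.support α₁).Finite ∧ (Function.support α₂).Finite ∧
        (Function.support α₃).Finite) →
      (∀ h : F[X], α₁ h ≠ 0 → h.Monic ∧ Squarefree h) →
      (∀ h : F[X], α₂ h ≠ 0 → h.Monic ∧ Squarefree h) →
      (∀ h : F[X], α₃ h ≠ 0 → h.Monic ∧ Squarefree h) →
      (∀ h : F[X], h.Monic → ‖α₁ h‖ ≤ (tauP F h : ℝ) ^ B / pnorm F h) →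
      (∀ h : F[X], h.Monic → ‖α₂ h‖ ≤ (tauP F h : ℝ) ^ B / pnorm F h) →
      (∀ h : F[X], h.Monic → ‖α₃ h‖ ≤ (tauP F h : ℝ) ^ B / pnorm F h) →
      ∀ (X₁ X₂ X₃ : ℝ) (b r : F[X]), r ≠ 0 →
        ‖tripleBeta p F α₁ α₂ α₃ y₁ y₂ y₃ b r (fun _ => True) (fun _ => True) (fun _ => True) -
          tripleBeta p F α₁ α₂ α₃ y₁ y₂ y₃ b r (fun h => (h.natDegree : ℝ) ≤ X₁)
            (fun h => (h.natDegree : ℝ) ≤ X₂) (fun h => (h.natDegree : ℝ) ≤ X₃)‖ ≤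
          C * (pnorm F r ^ ε * (Fintype.card F : ℝ) ^ (min X₁ (min X₂ X₃) * (ε - 1))) := by
  have hq : (0 : ℝ) < Fintype.card F := one_pos.trans one_lt_card_real
  obtain ⟨K, hK0, hK⟩ := exists_tauP_rpow_le (F := F) (δ := ε / 4) hB (by positivity)
  obtain ⟨D, hD0, hD⟩ := exists_sum_triples_le (F := F) hε hε'
  set M : ℝ :=
    (((Fintype.card F ^ ((y₁ - y₂) * (y₁ - y₃) * (y₂ - y₃)).natDegree) ^ 3 : ℕ) : ℝ) with hM
  have hM0 : 0 < M := by rw [hM]; push_cast; positivity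
  refine ⟨M * K ^ 3 * (3 * D), by positivity, ?_⟩
  intro α₁ α₂ α₃ hfin ms₁ ms₂ ms₃ hα₁ hα₂ hα₃ X₁ X₂ X₃ b r hr
  set X := min X₁ (min X₂ X₃) with hX
  have hX₁ : X ≤ X₁ := min_le_left _ _
  have hX₂ : X ≤ X₂ := (min_le_right _ _).trans (min_le_left _ _)
  have hX₃ : X ≤ X₃ := (min_le_right _ _).trans (min_le_right _ _)
  set S₁ := hfin.1.toFinset with hS₁
  set S₂ := hfin.2.1.toFinset with hS₂
  set S₃ := hfin.2.2.toFinset with hS₃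
  have n₁ : ∀ h, α₁ h ≠ 0 → h ∈ S₁ := fun h hh => hfin.1.mem_toFinset.2 hh
  have n₂ : ∀ h, α₂ h ≠ 0 → h ∈ S₂ := fun h hh => hfin.2.1.mem_toFinset.2 hh
  have n₃ : ∀ h, α₃ h ≠ 0 → h ∈ S₃ := fun h hh => hfin.2.2.mem_toFinset.2 hh
  have s₁ : ∀ h ∈ S₁, h.Monic ∧ Squarefree h := fun h hh => ms₁ h (hfin.1.mem_toFinset.1 hh)
  have s₂ : ∀ h ∈ S₂, h.Monic ∧ Squarefree h := fun h hh => ms₂ h (hfin.2.1.mem_toFinset.1 hh)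
  have s₃ : ∀ h ∈ S₃, h.Monic ∧ Squarefree h := fun h hh => ms₃ h (hfin.2.2.mem_toFinset.1 hh)
  have hexp := tripleBeta_eq_sum p (fun h hh => (s₁ h hh).1) (fun h hh => (s₂ h hh).1)
    (fun h hh => (s₃ h hh).1) n₁ n₂ n₃ y₁ y₂ y₃ b r
  rw [hexp, hexp, ← Finset.sum_sub_distrib]
  set U := S₁ ×ˢ S₂ ×ˢ S₃ with hU
  set R : F[X] × F[X] × F[X] → ℂ := fun i => reducedSum p y₁ y₂ y₃ b r i.1 i.2.1 i.2.2 with hR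
  set w : F[X] × F[X] × F[X] → ℝ := fun i =>
    (pnorm F i.1 * pnorm F i.2.1 * pnorm F i.2.2) ^ (-1 + ε / 4) with hw
  have hUm : ∀ i ∈ U, (i.1.Monic ∧ Squarefree i.1) ∧ (i.2.1.Monic ∧ Squarefree i.2.1) ∧
      (i.2.2.Monic ∧ Squarefree i.2.2) := fun i hi => by
    simp only [hU, Finset.mem_product] at hi
    exact ⟨s₁ _ hi.1, s₂ _ hi.2.1, s₃ _ hi.2.2⟩
  have hUd : ∀ i ∈ U, R i ≠ 0 → i.1 ∣ i.2.1 * i.2.2 * r ∧ i.2.1 ∣ i.1 * i.2.2 * r ∧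
      i.2.2 ∣ i.1 * i.2.1 * r := fun i hi h0 =>
    dvd_of_reducedSum_ne_zero p (hUm i hi).1.1.ne_zero (hUm i hi).2.1.1.ne_zero
      (hUm i hi).2.2.1.ne_zero hr h0
  have hw0 : ∀ i ∈ U, 0 ≤ w i := fun i hi => by
    have h1 := pnorm_pos (hUm i hi).1.1.ne_zero
    have h2 := pnorm_pos (hUm i hi).2.1.1.ne_zero
    have h3 := pnorm_pos (hUm i hi).2.2.1.ne_zero
    positivity
  have hterm : ∀ i ∈ U, ‖α₁ i.1 * α₂ i.2.1 * α₃ i.2.2 * R i‖ ≤ M * K ^ 3 * w i := fun i hi => by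
    obtain ⟨⟨a₁, b₁⟩, ⟨a₂, b₂⟩, a₃, b₃⟩ := hUm i hi
    have c₁ := pnorm_pos a₁.ne_zero
    have c₂ := pnorm_pos a₂.ne_zero
    have c₃ := pnorm_pos a₃.ne_zero
    have k₁ := norm_coeff_mul_tauP_le a₁ hK (hα₁ _ a₁)
    have k₂ := norm_coeff_mul_tauP_le a₂ hK (hα₂ _ a₂)
    have k₃ := norm_coeff_mul_tauP_le a₃ hK (hα₃ _ a₃)
    have k₄ := norm_reducedSum_le p hy12 hy13 hy23 a₁ a₂ a₃ b₁ b₂ b₃ b r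
    calc ‖α₁ i.1 * α₂ i.2.1 * α₃ i.2.2 * R i‖
        = ‖α₁ i.1‖ * ‖α₂ i.2.1‖ * ‖α₃ i.2.2‖ * ‖R i‖ := by simp only [norm_mul]
      _ ≤ ‖α₁ i.1‖ * ‖α₂ i.2.1‖ * ‖α₃ i.2.2‖ *
          (M * (tauP F i.1 * tauP F i.2.1 * tauP F i.2.2)) := by gcongr
      _ = M * ((‖α₁ i.1‖ * tauP F i.1) * (‖α₂ i.2.1‖ * tauP F i.2.1) *
          (‖α₃ i.2.2‖ * tauP F i.2.2)) := by ring
      _ ≤ M * ((K * pnorm F i.1 ^ (-1 + ε / 4)) * (K * pnorm F i.2.1 ^ (-1 + ε / 4)) *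
          (K * pnorm F i.2.2 ^ (-1 + ε / 4))) := by gcongr
      _ = M * K ^ 3 * w i := by
        rw [hw]
        dsimp only
        rw [Real.mul_rpow (by positivity) c₃.le, Real.mul_rpow c₁.le c₂.le]
        ring
  have hD₁ := hD _ (U.filter fun i => R i ≠ 0 ∧ X₁ < i.1.natDegree) (fun i => i.1)
    (fun i => i.2.1) (fun i => i.2.2) r X
    (fun i _ j _ e₁ e₂ e₃ => Prod.ext e₁ (Prod.ext e₂ e₃)) hr fun i hi => by
      obtain ⟨hi, h0, hd⟩ := Finset.mem_filter.1 hi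
      have hdv := hUd i hi h0
      exact ⟨(hUm i hi).1.1, (hUm i hi).2.1.1, (hUm i hi).2.2.1, hdv.1, hdv.2.1, hdv.2.2,
        hX₁.trans hd.le⟩
  have hD₂ := hD _ (U.filter fun i => R i ≠ 0 ∧ X₂ < i.2.1.natDegree) (fun i => i.2.1)
    (fun i => i.1) (fun i => i.2.2) r X
    (fun i _ j _ e₁ e₂ e₃ => Prod.ext e₂ (Prod.ext e₁ e₃)) hr fun i hi => by
      obtain ⟨hi, h0, hd⟩ := Finset.mem_filter.1 hi
      have hdv := hUd i hi h0
      exact ⟨(hUm i hi).2.1.1, (hUm i hi).1.1, (hUm i hi).2.2.1, hdv.2.1, hdv.1,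
        mul_comm i.1 i.2.1 ▸ hdv.2.2, hX₂.trans hd.le⟩
  have hD₃ := hD _ (U.filter fun i => R i ≠ 0 ∧ X₃ < i.2.2.natDegree) (fun i => i.2.2)
    (fun i => i.1) (fun i => i.2.1) r X
    (fun i _ j _ e₁ e₂ e₃ => Prod.ext e₂ (Prod.ext e₃ e₁)) hr fun i hi => by
      obtain ⟨hi, h0, hd⟩ := Finset.mem_filter.1 hi
      have hdv := hUd i hi h0
      exact ⟨(hUm i hi).2.2.1, (hUm i hi).1.1, (hUm i hi).2.1.1, hdv.2.2,
        mul_comm i.2.1 i.2.2 ▸ hdv.1, mul_comm i.1 i.2.2 ▸ hdv.2.1, hX₃.trans hd.le⟩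
  have hw₁ : ∀ i : F[X] × F[X] × F[X],
      (pnorm F i.2.1 * pnorm F i.1 * pnorm F i.2.2) ^ (-1 + ε / 4) = w i := fun i => by
    rw [hw]; ring_nf
  have hw₂ : ∀ i : F[X] × F[X] × F[X],
      (pnorm F i.2.2 * pnorm F i.1 * pnorm F i.2.1) ^ (-1 + ε / 4) = w i := fun i => by
    rw [hw]; ring_nf
  simp only [hw₁] at hD₂
  simp only [hw₂] at hD₃
  rw [Finset.sum_filter] at hD₁ hD₂ hD₃
  calc _ ≤ ∑ i ∈ U, M * K ^ 3 * ((if R i ≠ 0 ∧ X₁ < i.1.natDegree then w i else 0) +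
          (if R i ≠ 0 ∧ X₂ < i.2.1.natDegree then w i else 0) +
          (if R i ≠ 0 ∧ X₃ < i.2.2.natDegree then w i else 0)) := by
        refine norm_sum_le_of_le _ fun i hi => ?_
        have h1 := hterm i hi
        have h0 := hw0 i hi
        have hMK : 0 < M * K ^ 3 := by positivity
        have hnn : ∀ c : Prop, 0 ≤ if R i ≠ 0 ∧ c then w i else 0 := fun c => by
          split_ifs
          exacts [h0, le_rfl]
        have g₁ := hnn (X₁ < i.1.natDegree)
        have g₂ := hnn (X₂ < i.2.1.natDegree)
        have g₃ := hnn (X₃ < i.2.2.natDegree)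
        rw [if_pos ⟨trivial, trivial, trivial⟩]
        by_cases hc : (i.1.natDegree : ℝ) ≤ X₁ ∧ (i.2.1.natDegree : ℝ) ≤ X₂ ∧
            (i.2.2.natDegree : ℝ) ≤ X₃
        · rw [if_pos hc, sub_self, norm_zero]
          positivity
        · rw [if_neg hc, sub_zero]
          by_cases hRi : R i = 0
          · rw [show reducedSum p y₁ y₂ y₃ b r i.1 i.2.1 i.2.2 = 0 from hRi, mul_zero, norm_zero]
            positivity
          · refine h1.trans (mul_le_mul_of_nonneg_left ?_ hMK.le)
            simp only [not_and_or, not_le] at hc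
            rcases hc with hc | hc | hc
            · rw [if_pos ⟨hRi, hc⟩]
              linarith
            · rw [if_pos (⟨hRi, hc⟩ : R i ≠ 0 ∧ X₂ < i.2.1.natDegree)]
              linarith
            · rw [if_pos (⟨hRi, hc⟩ : R i ≠ 0 ∧ X₃ < i.2.2.natDegree)]
              linarith
    _ = M * K ^ 3 * ((∑ i ∈ U, if R i ≠ 0 ∧ X₁ < i.1.natDegree then w i else 0) +
          (∑ i ∈ U, if R i ≠ 0 ∧ X₂ < i.2.1.natDegree then w i else 0) +
          (∑ i ∈ U, if R i ≠ 0 ∧ X₃ < i.2.2.natDegree then w i else 0)) := by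
        rw [← Finset.mul_sum, Finset.sum_add_distrib, Finset.sum_add_distrib]
    _ ≤ M * K ^ 3 * (D * pnorm F r ^ ε * (Fintype.card F : ℝ) ^ (X * (ε - 1)) +
          D * pnorm F r ^ ε * (Fintype.card F : ℝ) ^ (X * (ε - 1)) +
          D * pnorm F r ^ ε * (Fintype.card F : ℝ) ^ (X * (ε - 1))) := by
        gcongr
    _ = _ := by ring

/-- Triple correlations of Ramanujan expansions: the Fourier coefficients of the full and the
truncated triple correlations differ by at most `C·⟨r⟩^ε·q^(X(ε−1))`, `X = min Xᵢ`. -/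
theorem triple_correlation_truncation
    (B ε : ℝ) (hB : 0 < B) (hε : 0 < ε) (y₁ y₂ y₃ : Polynomial Fq)
    (hy12 : y₁ ≠ y₂) (hy13 : y₁ ≠ y₃) (hy23 : y₂ ≠ y₃) :
    ∃ C : ℝ, 0 < C ∧
      ∀ α₁ α₂ α₃ : Polynomial Fq → ℂ,
        ((Function.support α₁).Finite ∧ (Function.support α₂).Finite ∧
          (Function.support α₃).Finite) →
        (∀ h : Polynomial Fq, α₁ h ≠ 0 → h.Monic ∧ Squarefree h) →
        (∀ h : Polynomial Fq, α₂ h ≠ 0 → h.Monic ∧ Squarefree h) →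
        (∀ h : Polynomial Fq, α₃ h ≠ 0 → h.Monic ∧ Squarefree h) →
        (∀ h : Polynomial Fq, h.Monic → ‖α₁ h‖ ≤ (tauP Fq h : ℝ) ^ B / pnorm Fq h) →
        (∀ h : Polynomial Fq, h.Monic → ‖α₂ h‖ ≤ (tauP Fq h : ℝ) ^ B / pnorm Fq h) →
        (∀ h : Polynomial Fq, h.Monic → ‖α₃ h‖ ≤ (tauP Fq h : ℝ) ^ B / pnorm Fq h) →
        ∀ X₁ X₂ X₃ : ℝ, 0 < X₁ → 0 < X₂ → 0 < X₃ →
          ∀ b r : Polynomial Fq, r.Monic → IsCoprime b r →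
            ‖tripleBeta p Fq α₁ α₂ α₃ y₁ y₂ y₃ b r
                (fun _ => True) (fun _ => True) (fun _ => True) -
              tripleBeta p Fq α₁ α₂ α₃ y₁ y₂ y₃ b r
                (fun h => (h.natDegree : ℝ) ≤ X₁) (fun h => (h.natDegree : ℝ) ≤ X₂)
                (fun h => (h.natDegree : ℝ) ≤ X₃)‖ ≤
              C * pnorm Fq r ^ ε *
                (Fintype.card Fq : ℝ) ^ (min X₁ (min X₂ X₃) * (ε - 1)) := by
  set ε' := min ε (1 / 2) with hε'
  have hε'0 : 0 < ε' := lt_min hε (by norm_num)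
  have hle : ε' ≤ ε := min_le_left _ _
  obtain ⟨C, hC0, hC⟩ := exists_norm_tripleBeta_sub_le p hB hε'0 (min_le_right _ _)
    hy12 hy13 hy23
  refine ⟨C, hC0, fun α₁ α₂ α₃ hfin m₁ m₂ m₃ hα₁ hα₂ hα₃ X₁ X₂ X₃ hX₁ hX₂ hX₃ b r hr _ => ?_⟩
  have hX : 0 < min X₁ (min X₂ X₃) := lt_min hX₁ (lt_min hX₂ hX₃)
  refine (hC α₁ α₂ α₃ hfin m₁ m₂ m₃ hα₁ hα₂ hα₃ X₁ X₂ X₃ b r hr.ne_zero).trans ?_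
  rw [mul_assoc]
  have hr1 := one_le_pnorm hr.ne_zero
  have hq := one_lt_card_real (F := Fq)
  gcongr
  exact hq.le

end
end
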